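/- arXiv:2305.07752 — 2 statements merged into one kernel-verified Lean document; each statement's English description precedes it below -/
import Mathlib

section
/- Every simple graph G with maximum degree d and chromatic index d+1 contains two vertices x and y together with a collection of d pairwise edge-disjoint paths between x and y. -/
open SimpleGraph

/-- `G` has a proper edge coloring with `n` colors. -/
def EdgeColorable {V : Type*} (G : SimpleGraph V) (n : ℕ) : Prop :=
  ∃ c : G.edgeSet → Fin n, ∀ e f : G.edgeSet, e ≠ f →
    (∃ v, v ∈ (e : Sym2 V) ∧ v ∈ (f : Sym2 V)) → c e ≠ c f

namespace EDP

open Finset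

/-- degree, counted classically -/
noncomputable def dg {V : Type*} [Fintype V] (G : SimpleGraph V) (v : V) : ℕ := by
  classical exact (univ.filter fun a => G.Adj v a).card

theorem dg_eq {V : Type*} [Fintype V] (G : SimpleGraph V) [DecidableRel G.Adj] (v : V) :
    dg G v = (univ.filter fun a => G.Adj v a).card := by
  unfold dg; congr

theorem dg_eq_degree {V : Type*} [Fintype V] (G : SimpleGraph V) [DecidableRel G.Adj] (v : V) :
    dg G v = G.degree v := by
  rw [dg_eq, ← SimpleGraph.card_neighborFinset_eq_degree]
  congr 1; ext a; simp

open Classical in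
theorem comp_sum {V : Type*} [Fintype V] (K : SimpleGraph V) (C : K.ConnectedComponent) :
    ∑ v ∈ univ.filter (fun v => K.connectedComponentMk v = C), (2 - (dg K v : ℤ)) ≤ 2 := by
  have h1 := C.connected_toSimpleGraph.card_vert_le_card_edgeSet_add_one
  have h2 := C.toSimpleGraph.sum_degrees_eq_twice_card_edges
  have h3 : ∀ v : C, C.toSimpleGraph.degree v = dg K v := by
    intro v
    rw [dg_eq, ← SimpleGraph.card_neighborFinset_eq_degree]
    refine Finset.card_bij (fun a _ => (a : V)) ?_ ?_ ?_
    · rintro ⟨a, ha⟩ h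
      simp only [mem_neighborFinset] at h
      simpa using (C.toSimpleGraph_adj v.2 ha).1 h
    · intro a _ b _ h; exact Subtype.ext h
    · intro b hb
      simp only [mem_filter, mem_univ, true_and] at hb
      have hbC : b ∈ C.supp := by
        have := v.2
        rw [ConnectedComponent.mem_supp_iff] 
        have h' : K.connectedComponentMk v.1 = C := v.2
        rw [← h']
        exact (ConnectedComponent.sound hb.symm.reachable)
      exact ⟨⟨b, hbC⟩, by simpa using (C.toSimpleGraph_adj v.2 hbC).2 hb, rfl⟩
  have h4 : ∑ v ∈ univ.filter (fun v => K.connectedComponentMk v = C), (2 - (dg K v : ℤ))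
      = ∑ v : C, (2 - (dg K v : ℤ)) := by
    apply Finset.sum_subtype
    intro x; simp; rfl
  rw [h4, Finset.sum_sub_distrib]
  simp only [h3] at h2
  have h5 : (∑ v : C, (dg K v : ℤ)) = 2 * (#C.toSimpleGraph.edgeFinset : ℤ) := by
    exact_mod_cast h2
  rw [h5]
  simp only [sum_const, card_univ, nsmul_eq_mul]
  rw [Nat.card_eq_fintype_card, Nat.card_eq_fintype_card, ← SimpleGraph.edgeFinset_card] at h1
  zify at h1
  linarith

open Classical in
theorem exists_comp {V : Type*} [Fintype V] (K : SimpleGraph V) (f : V → ℤ)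
    (hf : ∀ v, f v ≤ 2 - (dg K v : ℤ)) (hs : 0 < ∑ v, f v) :
    ∃ C : K.ConnectedComponent,
      1 ≤ ∑ v ∈ univ.filter (fun v => K.connectedComponentMk v = C), f v ∧
      ∑ v ∈ univ.filter (fun v => K.connectedComponentMk v = C), f v ≤ 2 := by
  rw [← Finset.sum_fiberwise univ K.connectedComponentMk f] at hs
  obtain ⟨C, -, hC⟩ := Finset.exists_lt_of_sum_lt (s := univ) (f := fun _ => (0:ℤ)) (by simpa using hs)
  exact ⟨C, hC, (Finset.sum_le_sum fun v _ => hf v).trans (comp_sum K C)⟩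

/-- proper edge colouring -/
def Proper {V κ : Type*} (G : SimpleGraph V) (c : Sym2 V → κ) : Prop :=
  ∀ u a b, G.Adj u a → G.Adj u b → a ≠ b → c s(u, a) ≠ c s(u, b)

/-- colour `i` is missing at `u` -/
def Miss {V κ : Type*} (G : SimpleGraph V) (c : Sym2 V → κ) (u : V) (i : κ) : Prop :=
  ∀ a, G.Adj u a → c s(u, a) ≠ i

/-- the Kempe graph of colours `i`, `j` -/
def kempe {V κ : Type*} (G : SimpleGraph V) (c : Sym2 V → κ) (i j : κ) : SimpleGraph V where
  Adj a b := G.Adj a b ∧ (c s(a, b) = i ∨ c s(a, b) = j)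
  symm := ⟨fun a b h => ⟨h.1.symm, by rw [Sym2.eq_swap]; exact h.2⟩⟩
  loopless := ⟨fun a h => G.loopless.irrefl a h.1⟩

theorem kempe_dg {V κ : Type*} [Fintype V] (G : SimpleGraph V) (c : Sym2 V → κ) (i j : κ)
    (hc : Proper G c) (v : V) : dg (kempe G c i j) v ≤ 2 := by
  classical
  rw [dg_eq]
  have : #(univ.filter fun a => (kempe G c i j).Adj v a) ≤ #({i, j} : Finset κ) := by
    apply Finset.card_le_card_of_injOn (fun a => c s(v, a))
    · intro a ha
      replace ha : (kempe G c i j).Adj v a := (Finset.mem_filter.1 ha).2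
      simpa using ha.2
    · intro a ha b hb h
      replace ha : (kempe G c i j).Adj v a := (Finset.mem_filter.1 ha).2
      replace hb : (kempe G c i j).Adj v b := (Finset.mem_filter.1 hb).2
      by_contra hab
      exact hc v a b ha.1 hb.1 hab h
  exact this.trans Finset.card_le_two

theorem kempe_dg' {V κ : Type*} [Fintype V] (G : SimpleGraph V) (c : Sym2 V → κ) (i j : κ)
    (hc : Proper G c) (v : V) (h : Miss G c v i) : dg (kempe G c i j) v ≤ 1 := by
  classical
  rw [dg_eq]
  have : #(univ.filter fun a => (kempe G c i j).Adj v a) ≤ #({j} : Finset κ) := by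
    apply Finset.card_le_card_of_injOn (fun a => c s(v, a))
    · intro a ha
      replace ha : (kempe G c i j).Adj v a := (Finset.mem_filter.1 ha).2
      simpa using ha.2.resolve_left (h a ha.1)
    · intro a ha b hb h
      replace ha : (kempe G c i j).Adj v a := (Finset.mem_filter.1 ha).2
      replace hb : (kempe G c i j).Adj v b := (Finset.mem_filter.1 hb).2
      by_contra hab
      exact hc v a b ha.1 hb.1 hab h
  simpa using this

open Classical in
theorem kempe_swap {V κ : Type*} (G : SimpleGraph V) (c : Sym2 V → κ) (i j : κ)
    (hc : Proper G c) (C : (kempe G c i j).ConnectedComponent) :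
    ∃ c' : Sym2 V → κ, Proper G c' ∧ (∀ a b, G.Adj a b → c' s(a, b) =
      if (kempe G c i j).connectedComponentMk a = C then Equiv.swap i j (c s(a, b))
        else c s(a, b)) := by
  have key : ∀ a b, G.Adj a b → (if ∃ v ∈ s(a,b), (kempe G c i j).connectedComponentMk v = C then
      Equiv.swap i j (c s(a,b)) else c s(a,b)) =
      if (kempe G c i j).connectedComponentMk a = C then Equiv.swap i j (c s(a, b))
        else c s(a, b) := by
    intro a b hab
    by_cases h : c s(a, b) = i ∨ c s(a, b) = j
    · have hk : (kempe G c i j).Adj a b := ⟨hab, h⟩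
      have : (kempe G c i j).connectedComponentMk a = (kempe G c i j).connectedComponentMk b :=
        ConnectedComponent.sound hk.reachable
      simp [this]
    · push Not at h
      rw [Equiv.swap_apply_of_ne_of_ne h.1 h.2]; simp
  refine ⟨fun e => if ∃ v ∈ e, (kempe G c i j).connectedComponentMk v = C then
      Equiv.swap i j (c e) else c e, ?_, key⟩
  intro u a b ha hb hab
  show (if ∃ v ∈ s(u,a), _ then _ else _) ≠ (if ∃ v ∈ s(u,b), _ then _ else _)
  rw [key u a ha, key u b hb]
  split_ifs
  · exact fun h => hc u a b ha hb hab ((Equiv.swap i j).injective h)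
  · exact hc u a b ha hb hab

/-- admissible state: colouring `c` with lists `L` of missing colours -/
structure Good {V κ : Type*} (G : SimpleGraph V) (c₀ : Sym2 V → κ) (N : Finset V) (C : Finset κ)
    (t : V → ℕ) (c : Sym2 V → κ) (L : V → Finset κ) : Prop where
  proper : Proper G c
  agree : ∀ a b, G.Adj a b → ∀ i, i ∉ C → (c s(a, b) = i ↔ c₀ s(a, b) = i)
  sub : ∀ u ∈ N, L u ⊆ C
  miss : ∀ u ∈ N, ∀ i ∈ L u, Miss G c u i
  card : ∀ u ∈ N, (L u).card = t u

open Classical in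
/-- number of vertices having `k` in their list -/
noncomputable def cnt {V κ : Type*} (N : Finset V) (L : V → Finset κ) (k : κ) : ℕ :=
  ∑ u ∈ N, if k ∈ L u then 1 else 0

open Classical in
theorem step {V κ : Type*} [Fintype V] (G : SimpleGraph V) (c₀ : Sym2 V → κ) (N : Finset V)
    (C : Finset κ) (t : V → ℕ) (c : Sym2 V → κ) (L : V → Finset κ) (h : Good G c₀ N C t c L)
    (i j : κ) (hi : i ∈ C) (hj : j ∈ C) (hij : cnt N L j + 3 ≤ cnt N L i) :
    ∃ c' L', Good G c₀ N C t c' L' ∧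
      ∑ k ∈ C, (cnt N L' k) ^ 2 < ∑ k ∈ C, (cnt N L k) ^ 2 := by
  have hne : i ≠ j := by rintro rfl; omega
  set K := kempe G c i j with hK
  let f : V → ℤ := fun u => if u ∈ N then (if i ∈ L u then 1 else 0) - (if j ∈ L u then 1 else 0)
    else 0
  have hf : ∀ v, f v ≤ 2 - (dg K v : ℤ) := by
    intro v
    have h2 := kempe_dg G c i j h.proper v
    have h1 : v ∈ N → i ∈ L v → dg K v ≤ 1 := fun hv hiv =>
      kempe_dg' G c i j h.proper v (h.miss v hv i hiv)
    rw [← hK] at h2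
    simp only [f]
    split_ifs with a b d d
    · omega
    · have := h1 a b; omega
    · omega
    · omega
    · omega
  have hfs : ∑ v, f v = (cnt N L i : ℤ) - cnt N L j := by
    simp only [f, cnt]
    rw [← Finset.sum_filter]
    simp
  obtain ⟨D, hD1, hD2⟩ := exists_comp K f hf (by rw [hfs]; omega)
  set w := ∑ v ∈ univ.filter (fun v => K.connectedComponentMk v = D), f v with hw
  obtain ⟨c', hc', hcc⟩ := kempe_swap G c i j h.proper D
  replace hcc : ∀ a b, G.Adj a b → c' s(a, b) =
      if K.connectedComponentMk a = D then Equiv.swap i j (c s(a, b)) else c s(a, b) := hcc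
  let L' : V → Finset κ := fun u => if K.connectedComponentMk u = D then
    (L u).map (Equiv.swap i j).toEmbedding else L u
  have hL' : ∀ u k, k ∈ L' u ↔ (if K.connectedComponentMk u = D then Equiv.swap i j k ∈ L u
      else k ∈ L u) := by
    intro u k
    simp only [L']
    split_ifs
    · rw [Finset.mem_map_equiv]; simp
    · rfl
  have hswapC : ∀ k, Equiv.swap i j k ∈ C ↔ k ∈ C := by
    intro k
    rcases eq_or_ne k i with rfl | h1
    · simp [hi, hj]
    rcases eq_or_ne k j with rfl | h2
    · simp [hi, hj]
    rw [Equiv.swap_apply_of_ne_of_ne h1 h2]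
  refine ⟨c', L', ⟨hc', ?_, ?_, ?_, ?_⟩, ?_⟩
  · intro a b hab k hk
    rw [hcc a b hab, ← h.agree a b hab k hk]
    split_ifs
    · have h1 : k ≠ i := by rintro rfl; exact hk hi
      have h2 : k ≠ j := by rintro rfl; exact hk hj
      rw [Equiv.swap_apply_eq_iff, Equiv.swap_apply_of_ne_of_ne h1 h2]
    · rfl
  · intro u hu k hk
    rw [hL'] at hk
    split_ifs at hk
    · exact (hswapC k).1 (h.sub u hu hk)
    · exact h.sub u hu hk
  · intro u hu k hk a ha
    rw [hL'] at hk
    rw [hcc u a ha]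
    split_ifs at hk ⊢
    · rw [Ne, Equiv.swap_apply_eq_iff]
      exact h.miss u hu _ hk a ha
    · exact h.miss u hu _ hk a ha
  · intro u hu
    simp only [L']
    split_ifs
    · rw [Finset.card_map]; exact h.card u hu
    · exact h.card u hu
  · have hw' : w = ∑ u ∈ N, if K.connectedComponentMk u = D then
        ((if i ∈ L u then 1 else 0) - (if j ∈ L u then 1 else 0) : ℤ) else 0 := by
      rw [hw, Finset.sum_filter]
      simp only [f]
      rw [← Finset.sum_filter_add_sum_filter_not univ (· ∈ N)]
      rw [Finset.sum_congr (s₂ := N) (g := fun u => if K.connectedComponentMk u = D then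
        ((if i ∈ L u then 1 else 0) - (if j ∈ L u then 1 else 0) : ℤ) else 0)]
      · rw [Finset.sum_eq_zero (s := filter _ _), add_zero]
        intro x hx
        simp at hx
        simp [hx]
      · ext; simp
      · intro x hx; simp [hx]
    have hXi : (cnt N L' i : ℤ) = cnt N L i - w := by
      rw [hw']
      simp only [cnt]
      push_cast
      rw [← Finset.sum_sub_distrib]
      refine Finset.sum_congr rfl fun u _ => ?_
      simp only [hL', Equiv.swap_apply_left]
      split_ifs <;> simp
    have hXj : (cnt N L' j : ℤ) = cnt N L j + w := by
      rw [hw']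
      simp only [cnt]
      push_cast
      rw [← Finset.sum_add_distrib]
      refine Finset.sum_congr rfl fun u _ => ?_
      simp only [hL', Equiv.swap_apply_right]
      split_ifs <;> simp
    have hXk : ∀ k, k ≠ i → k ≠ j → cnt N L' k = cnt N L k := by
      intro k h1 h2
      simp only [cnt]
      refine Finset.sum_congr rfl fun u _ => ?_
      simp only [hL', Equiv.swap_apply_of_ne_of_ne h1 h2]
      split_ifs <;> simp
    have hsum : ∀ M : V → Finset κ, ∑ k ∈ C, (cnt N M k) ^ 2 =
        (cnt N M i) ^ 2 + ((cnt N M j) ^ 2 + ∑ k ∈ (C.erase i).erase j, (cnt N M k) ^ 2) := by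
      intro M
      rw [← Finset.add_sum_erase C _ hi, ← Finset.add_sum_erase (C.erase i) _
        (Finset.mem_erase.2 ⟨hne.symm, hj⟩)]
    rw [hsum L, hsum L']
    have : ∑ k ∈ (C.erase i).erase j, (cnt N L' k) ^ 2
        = ∑ k ∈ (C.erase i).erase j, (cnt N L k) ^ 2 := by
      refine Finset.sum_congr rfl fun k hk => ?_
      simp only [Finset.mem_erase] at hk
      rw [hXk k hk.2.1 hk.1]
    rw [this]
    zify
    rw [hXi, hXj]
    zify at hij
    nlinarith

open Classical in
theorem exists_one {V κ : Type*} [Fintype V] (G : SimpleGraph V) (c₀ : Sym2 V → κ) (N : Finset V)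
    (C : Finset κ) (u₀ : V) (hu₀ : u₀ ∈ N) (hNC : N.card ≤ C.card) (c : Sym2 V → κ)
    (L : V → Finset κ) (h : Good G c₀ N C (fun u => if u = u₀ then 1 else 2) c L) :
    ∃ c' L', Good G c₀ N C (fun u => if u = u₀ then 1 else 2) c' L' ∧ ∃ k ∈ C, cnt N L' k = 1 := by
  induction hn : ∑ k ∈ C, (cnt N L k) ^ 2 using Nat.strong_induction_on generalizing c L with
  | _ n ih =>
    by_cases hex : ∃ i ∈ C, ∃ j ∈ C, cnt N L j + 3 ≤ cnt N L i
    · obtain ⟨i, hi, j, hj, hij⟩ := hex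
      obtain ⟨c', L', h', hlt⟩ := step G c₀ N C _ c L h i j hi hj hij
      exact ih _ (hn ▸ hlt) c' L' h' rfl
    · push Not at hex
      refine ⟨c, L, h, ?_⟩
      by_contra hone
      push Not at hone
      have hsum : ∑ k ∈ C, cnt N L k + 1 = 2 * N.card := by
        simp only [cnt]
        rw [Finset.sum_comm]
        have : ∀ u ∈ N, (∑ k ∈ C, if k ∈ L u then 1 else 0) = if u = u₀ then 1 else 2 := by
          intro u hu
          rw [← h.card u hu, ← Finset.sum_filter, ← Finset.card_eq_sum_ones]
          congr 1
          ext k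
          simp only [mem_filter]
          exact ⟨fun h => h.2, fun hk => ⟨h.sub u hu hk, hk⟩⟩
        rw [Finset.sum_congr rfl this, ← Finset.add_sum_erase N _ hu₀]
        have h2 : ∑ x ∈ N.erase u₀, (if x = u₀ then 1 else 2) = 2 * (N.erase u₀).card := by
          rw [Finset.sum_congr rfl (g := fun _ => 2)]
          · simp [mul_comm]
          · intro x hx; simp [(Finset.mem_erase.1 hx).1]
        rw [h2, ← Finset.card_erase_add_one hu₀]
        simp; ring
      have hodd : ∃ k ∈ C, Odd (cnt N L k) := by
        by_contra hno
        push Not at hno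
        have : Even (∑ k ∈ C, cnt N L k) := by
          refine Finset.even_sum _ fun k hk => ?_
          simpa using hno k hk
        obtain ⟨r, hr⟩ := this
        omega
      obtain ⟨k, hk, hko⟩ := hodd
      have hk1 := hone k hk
      obtain ⟨r, hr⟩ := hko
      have hall : ∀ j ∈ C, 2 ≤ cnt N L j := by
        intro j hj
        have := hex k hk j hj
        have := hone j hj
        omega
      have h6 : #C * 2 ≤ ∑ k ∈ C, cnt N L k := by
        simpa using Finset.card_nsmul_le_sum C _ 2 hall
      have h7 : 0 < #N := Finset.card_pos.2 ⟨u₀, hu₀⟩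
      omega

open Classical in
theorem balance {V κ : Type*} [Fintype V] (G : SimpleGraph V) (n : ℕ) :
    ∀ (N : Finset V) (C : Finset κ) (c : Sym2 V → κ) (u₀ : V), N.card = n → N.card ≤ C.card →
    Proper G c → (∀ u ∈ N, ∃ L ⊆ C, (∀ i ∈ L, Miss G c u i) ∧ L.card = if u = u₀ then 1 else 2) →
    ∃ c' : Sym2 V → κ, Proper G c' ∧
      (∀ a b, G.Adj a b → ∀ i, i ∉ C → (c' s(a, b) = i ↔ c s(a, b) = i)) ∧
      ∃ g : V → κ, Set.InjOn g N ∧ ∀ u ∈ N, g u ∈ C ∧ Miss G c' u (g u) := by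
  induction n with
  | zero =>
    intro N C c u₀ hN _ hc _
    rw [Finset.card_eq_zero] at hN
    subst hN
    exact ⟨c, hc, fun _ _ _ _ _ => Iff.rfl, fun v => c s(v, v), by simp, by simp⟩
  | succ n ih =>
    intro N C c u₁ hN hNC hc hL
    -- choose the special vertex inside `N`
    obtain ⟨u₀, hu₀, hL⟩ : ∃ u₀ ∈ N, ∀ u ∈ N, ∃ L ⊆ C, (∀ i ∈ L, Miss G c u i) ∧
        L.card = if u = u₀ then 1 else 2 := by
      by_cases h1 : u₁ ∈ N
      · exact ⟨u₁, h1, hL⟩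
      · obtain ⟨u₀, hu₀⟩ : N.Nonempty := Finset.card_pos.1 (by omega)
        refine ⟨u₀, hu₀, fun u hu => ?_⟩
        obtain ⟨L, hLC, hLm, hLc⟩ := hL u hu
        have : u ≠ u₁ := by rintro rfl; exact h1 hu
        rw [if_neg this] at hLc
        split_ifs
        · obtain ⟨L', hL', hc'⟩ := Finset.exists_subset_card_eq (s := L) (n := 1) (by omega)
          exact ⟨L', hL'.trans hLC, fun i hi => hLm i (hL' hi), hc'⟩
        · exact ⟨L, hLC, hLm, hLc⟩
    choose! L hLC hLm hLc using hL
    obtain ⟨c', L', h', k, hk, hk1⟩ := exists_one G c N C u₀ hu₀ hNC c L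
      ⟨hc, fun _ _ _ _ _ => Iff.rfl, hLC, hLm, hLc⟩
    have hk1' : (N.filter fun u => k ∈ L' u).card = 1 := by
      rw [← hk1, cnt, ← Finset.sum_filter, Finset.card_eq_sum_ones]
    obtain ⟨u, hu⟩ := Finset.card_eq_one.1 hk1'
    have huN : u ∈ N ∧ k ∈ L' u := by
      have : u ∈ N.filter fun u => k ∈ L' u := by rw [hu]; simp
      simpa using this
    have hother : ∀ v ∈ N, k ∈ L' v → v = u := by
      intro v hv hkv
      have : v ∈ N.filter fun u => k ∈ L' u := by simp [hv, hkv]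
      rw [hu] at this; simpa using this
    obtain ⟨c'', hc'', hag, g, hg, hgm⟩ := ih (N.erase u) (C.erase k) c' u₀
      (by rw [Finset.card_erase_of_mem huN.1]; omega)
      (by rw [Finset.card_erase_of_mem huN.1, Finset.card_erase_of_mem hk]; omega)
      h'.proper (by
        intro v hv
        obtain ⟨hvu, hvN⟩ := Finset.mem_erase.1 hv
        refine ⟨L' v, fun i hi => Finset.mem_erase.2 ⟨?_, h'.sub v hvN hi⟩, h'.miss v hvN,
          h'.card v hvN⟩
        rintro rfl
        exact hvu (hother v hvN hi))
    refine ⟨c'', hc'', ?_, Function.update g u k, ?_, ?_⟩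
    · intro a b hab i hi
      rw [hag a b hab i (fun h => hi (Finset.mem_of_mem_erase h)), h'.agree a b hab i hi]
    · intro a ha b hb hab
      by_cases hau : a = u <;> by_cases hbu : b = u
      · rw [hau, hbu]
      · subst hau
        rw [Function.update_self, Function.update_of_ne hbu] at hab
        have := (hgm b (Finset.mem_erase.2 ⟨hbu, hb⟩)).1
        rw [← hab] at this
        simp at this
      · subst hbu
        rw [Function.update_self, Function.update_of_ne hau] at hab
        have := (hgm a (Finset.mem_erase.2 ⟨hau, ha⟩)).1
        rw [hab] at this
        simp at this
      · rw [Function.update_of_ne hau, Function.update_of_ne hbu] at hab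
        exact hg (Finset.mem_erase.2 ⟨hau, ha⟩) (Finset.mem_erase.2 ⟨hbu, hb⟩) hab
    · intro v hv
      by_cases hvu : v = u
      · subst hvu
        rw [Function.update_self]
        refine ⟨hk, fun a ha => ?_⟩
        rw [Ne, hag v a ha k (by simp)]
        exact h'.miss v hv k huN.2 a ha
      · rw [Function.update_of_ne hvu]
        obtain ⟨h1, h2⟩ := hgm v (Finset.mem_erase.2 ⟨hvu, hv⟩)
        exact ⟨Finset.mem_of_mem_erase h1, h2⟩

theorem miss_card {V : Type*} [Fintype V] (d : ℕ) (G : SimpleGraph V) (c : Sym2 V → Fin d) (u : V)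
    (m : ℕ) (h : dg G u + m ≤ d) :
    ∃ L : Finset (Fin d), (∀ i ∈ L, Miss G c u i) ∧ L.card = m := by
  classical
  set I := (univ.filter fun a => G.Adj u a).image (fun a => c s(u, a)) with hI
  have h1 : I.card ≤ dg G u := by rw [dg_eq]; exact Finset.card_image_le
  have h2 : m ≤ (Iᶜ).card := by rw [Finset.card_compl, Fintype.card_fin]; omega
  obtain ⟨L, hL, hc⟩ := Finset.exists_subset_card_eq h2
  refine ⟨L, fun i hi a ha hia => ?_, hc⟩
  have := hL hi
  rw [Finset.mem_compl] at this
  exact this (Finset.mem_image.2 ⟨a, by simpa using ha, hia⟩)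

/-- extending a colouring of `H - v` -/
theorem extend {V : Type*} [Fintype V] (d : ℕ) (H : SimpleGraph V) (hd : ∀ v, dg H v ≤ d) (v : V)
    (u₀ : V) (hu : ∀ u, H.Adj v u → dg H u = d → u = u₀)
    (c : Sym2 V → Fin d) (hc : Proper (H.deleteIncidenceSet v) c) :
    ∃ c' : Sym2 V → Fin d, Proper H c' := by
  classical
  have hdeg : ∀ u, H.Adj v u → dg (H.deleteIncidenceSet v) u + 1 ≤ dg H u := by
    intro u hvu
    rw [dg_eq, dg_eq]
    rw [Nat.add_one_le_iff]
    apply Finset.card_lt_card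
    rw [Finset.ssubset_iff_of_subset]
    · exact ⟨v, by simpa using hvu.symm, by simp [deleteIncidenceSet_adj]⟩
    · intro a; simp only [mem_filter, mem_univ, true_and, deleteIncidenceSet_adj]
      exact fun h => h.1
  obtain ⟨c', hc', -, g, hg, hgm⟩ := balance (H.deleteIncidenceSet v) _
    (univ.filter fun u => H.Adj v u) (univ : Finset (Fin d)) c u₀ rfl
    (by rw [← dg_eq]; simpa using hd v) hc (by
      intro u hvu
      simp only [mem_filter, mem_univ, true_and] at hvu
      have h1 := hdeg u hvu
      have h2 := hd u
      obtain ⟨L, hL, hLc⟩ := miss_card d (H.deleteIncidenceSet v) c u (if u = u₀ then 1 else 2) (by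
        split_ifs with h
        · omega
        · have : dg H u ≠ d := fun h' => h (hu u hvu h')
          omega)
      exact ⟨L, by simp, hL, hLc⟩)
  simp only [mem_filter, mem_univ, true_and] at hgm
  have hcv : ∀ (x y : V), x ≠ v → y ≠ v → ¬ v ∈ s(x, y) := by
    intro x y hx hy h
    rcases Sym2.mem_iff.1 h with h | h
    · exact hx h.symm
    · exact hy h.symm
  -- new colouring
  let c'' : Sym2 V → Fin d := fun e => if h : v ∈ e then g (Sym2.Mem.other h) else c' e
  have e1 : ∀ u, u ≠ v → c'' s(v, u) = g u := by
    intro u _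
    have hm : v ∈ s(v, u) := Sym2.mem_mk_left _ _
    have : Sym2.Mem.other hm = u := by
      have := Sym2.other_spec hm
      exact Sym2.congr_right.1 this
    simp only [c'', dif_pos hm, this]
  have e1' : ∀ u, u ≠ v → c'' s(u, v) = g u := by
    intro u h; rw [Sym2.eq_swap]; exact e1 u h
  have e2 : ∀ x y, x ≠ v → y ≠ v → c'' s(x, y) = c' s(x, y) := by
    intro x y hx hy
    simp only [c'', dif_neg (hcv x y hx hy)]
  refine ⟨c'', fun u a b ha hb hab => ?_⟩
  by_cases huv : u = v
  · subst huv
    rw [e1 a ha.ne', e1 b hb.ne']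
    intro h
    exact hab (hg (by simpa using ha) (by simpa using hb) h)
  · by_cases hav : a = v
    · subst hav
      rw [e1' u huv, e2 u b huv hab.symm]
      exact ((hgm u ha.symm) b (by simp [deleteIncidenceSet_adj, *, hab.symm])).symm
    · by_cases hbv : b = v
      · subst hbv
        rw [e1' u huv, e2 u a huv hab]
        exact ((hgm u hb.symm) a (by simp [deleteIncidenceSet_adj, *]))
      · rw [e2 u a huv hav, e2 u b huv hbv]
        exact hc' u a b (by simp [deleteIncidenceSet_adj, *]) (by simp [deleteIncidenceSet_adj, *]) hab

open Classical in
/-- number of edges leaving `A` -/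
noncomputable def cut {V : Type*} [Fintype V] (G : SimpleGraph V) (A : Finset V) : ℕ :=
  (univ.filter fun p : V × V => p.1 ∈ A ∧ p.2 ∉ A ∧ G.Adj p.1 p.2).card

open Classical in
theorem cut_compl {V : Type*} [Fintype V] (G : SimpleGraph V) (A : Finset V) :
    cut G Aᶜ = cut G A := by
  unfold cut
  refine Finset.card_bij (fun p _ => p.swap) ?_ ?_ ?_
  · rintro ⟨a, b⟩ h
    simp only [mem_filter, mem_univ, true_and, mem_compl, not_not, Prod.fst_swap,
      Prod.snd_swap] at h ⊢
    exact ⟨h.2.1, h.1, h.2.2.symm⟩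
  · intro p _ q _ h; exact Prod.swap_injective h
  · rintro ⟨a, b⟩ h
    simp only [mem_filter, mem_univ, true_and] at h
    refine ⟨(b, a), ?_, rfl⟩
    simp only [mem_filter, mem_univ, true_and, mem_compl, not_not]
    exact ⟨h.2.1, h.1, h.2.2.symm⟩

open Classical in
theorem cut_submod {V : Type*} [Fintype V] (G : SimpleGraph V) (A X : Finset V) :
    cut G (A ∩ X) + cut G (A ∪ X) ≤ cut G A + cut G X := by
  unfold cut
  simp only [Finset.card_filter]
  rw [← Finset.sum_add_distrib, ← Finset.sum_add_distrib]
  refine Finset.sum_le_sum fun p _ => ?_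
  by_cases h1 : p.1 ∈ A <;> by_cases h2 : p.1 ∈ X <;> by_cases h3 : p.2 ∈ A <;>
    by_cases h4 : p.2 ∈ X <;> by_cases h5 : G.Adj p.1 p.2 <;> simp [h1, h2, h3, h4, h5]

/-- integer unit flows -/
structure Flow {V : Type*} [Fintype V] (G : SimpleGraph V) (s t : V) (f : V → V → ℤ) : Prop where
  anti : ∀ u v, f u v = - f v u
  bd : ∀ u v, f u v ≤ 1
  supp : ∀ u v, ¬ G.Adj u v → f u v = 0
  cons : ∀ u, u ≠ s → u ≠ t → ∑ v, f u v = 0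

open Classical in
theorem flow_cut {V : Type*} [Fintype V] {G : SimpleGraph V} {s t : V} {f : V → V → ℤ}
    (hf : Flow G s t f) (S : Finset V) (hs : s ∈ S) (ht : t ∉ S) :
    ∑ v, f s v = ∑ p : V × V, if p.1 ∈ S ∧ p.2 ∉ S then f p.1 p.2 else 0 := by
  have h1 : ∑ u, ∑ v, (if u ∈ S then f u v else 0) = ∑ v, f s v := by
    rw [Finset.sum_eq_single s]
    · simp [hs]
    · intro u _ hu
      by_cases huS : u ∈ S
      · have : u ≠ t := by rintro rfl; exact ht huS
        simpa [huS] using hf.cons u hu this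
      · simp [huS]
    · simp
  have h2 : ∑ u, ∑ v, (if u ∈ S ∧ v ∈ S then f u v else 0) = 0 := by
    have : ∑ u, ∑ v, (if u ∈ S ∧ v ∈ S then f u v else 0) =
        - ∑ u, ∑ v, (if u ∈ S ∧ v ∈ S then f u v else 0) := by
      conv_lhs => rw [Finset.sum_comm]
      rw [← Finset.sum_neg_distrib]
      refine Finset.sum_congr rfl fun u _ => ?_
      rw [← Finset.sum_neg_distrib]
      refine Finset.sum_congr rfl fun v _ => ?_
      rw [hf.anti v u]
      by_cases a : u ∈ S <;> by_cases b : v ∈ S <;> simp [a, b]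
    omega
  rw [← h1, Fintype.sum_prod_type, ← sub_eq_zero, ← Finset.sum_sub_distrib]
  refine Eq.trans ?_ h2
  refine Finset.sum_congr rfl fun u _ => ?_
  rw [← Finset.sum_sub_distrib]
  refine Finset.sum_congr rfl fun v _ => ?_
  by_cases a : u ∈ S <;> by_cases b : v ∈ S <;> simp [a, b]

open Classical in
/-- the unit flow along a walk -/
noncomputable def pf {V : Type*} {G : SimpleGraph V} : {a b : V} → G.Walk a b → V → V → ℤ
  | _, _, .nil => fun _ _ => 0
  | _, _, .cons (u := u) (v := v) _ p => fun x y => pf p x y + (if x = u ∧ y = v then 1 else 0)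
      - (if x = v ∧ y = u then 1 else 0)

theorem pf_anti {V : Type*} {G : SimpleGraph V} {a b : V} (p : G.Walk a b) (x y : V) :
    pf p x y = - pf p y x := by
  classical
  induction p with
  | nil => simp [pf]
  | cons h p ih =>
    simp only [pf, ih]
    simp only [and_comm (a := y = _)]
    ring

open Classical in
theorem pf_div {V : Type*} [Fintype V] {G : SimpleGraph V} {a b : V} (p : G.Walk a b) (x : V) :
    ∑ y, pf p x y = (if x = a then 1 else 0) - (if x = b then 1 else 0) := by
  induction p with
  | nil => simp [pf]
  | cons h p ih =>
    simp only [pf, Finset.sum_sub_distrib, Finset.sum_add_distrib, ih, ite_and]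
    split_ifs <;> simp_all

theorem pf_not_mem {V : Type*} {G : SimpleGraph V} {a b : V} (p : G.Walk a b) (x y : V)
    (h : s(x, y) ∉ p.edges) : pf p x y = 0 := by
  classical
  induction p with
  | nil => simp [pf]
  | cons h' p ih =>
    simp only [Walk.edges_cons, List.mem_cons, not_or] at h
    simp only [pf]
    rw [ih h.2]
    have h1 := h.1
    rw [Sym2.eq_iff] at h1
    push Not at h1
    rw [if_neg (fun h => h1.1 h.1 h.2), if_neg (fun h => h1.2 h.1 h.2)]
    simp

theorem pf_dart {V : Type*} {G : SimpleGraph V} {a b : V} (p : G.Walk a b) (hp : p.IsTrail)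
    (e : G.Dart) (he : e ∈ p.darts) : pf p e.fst e.snd = 1 := by
  classical
  induction p with
  | nil => simp at he
  | @cons u v w h p ih =>
    rw [Walk.isTrail_cons] at hp
    simp only [Walk.darts_cons, List.mem_cons] at he
    rcases he with rfl | he
    · simp only [pf]
      rw [pf_not_mem p u v hp.2]
      have : u ≠ v := h.ne
      simp [this]
    · simp only [pf]
      rw [ih hp.1 he]
      have hm : s(e.fst, e.snd) ∈ p.edges := by
        rw [Walk.edges]; exact List.mem_map.2 ⟨e, he, rfl⟩
      rw [if_neg, if_neg]
      · simp
      · rintro ⟨h1, h2⟩; apply hp.2; rw [h1, h2, Sym2.eq_swap] at hm; exact hm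
      · rintro ⟨h1, h2⟩; apply hp.2; rw [h1, h2] at hm; exact hm

theorem mem_edges_dart {V : Type*} {G : SimpleGraph V} {a b : V} (p : G.Walk a b) (x y : V)
    (h : s(x, y) ∈ p.edges) :
    (∃ e ∈ p.darts, e.fst = x ∧ e.snd = y) ∨ (∃ e ∈ p.darts, e.fst = y ∧ e.snd = x) := by
  rw [Walk.edges, List.mem_map] at h
  obtain ⟨e, he, h⟩ := h
  have h' : s(e.fst, e.snd) = s(x, y) := h
  rw [Sym2.eq_iff] at h'
  rcases h' with h' | h'
  · exact Or.inl ⟨e, he, h'⟩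
  · exact Or.inr ⟨e, he, h'⟩

theorem pf_cases {V : Type*} {G : SimpleGraph V} {a b : V} (p : G.Walk a b) (hp : p.IsTrail)
    (x y : V) : pf p x y ≤ 0 ∨ (pf p x y = 1 ∧ ∃ e ∈ p.darts, e.fst = x ∧ e.snd = y) := by
  by_cases h : s(x, y) ∈ p.edges
  · rcases mem_edges_dart p x y h with ⟨e, he, rfl, rfl⟩ | ⟨e, he, rfl, rfl⟩
    · exact Or.inr ⟨pf_dart p hp e he, e, he, rfl, rfl⟩
    · left; rw [pf_anti, pf_dart p hp e he]; norm_num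
  · left; rw [pf_not_mem p x y h]

/-- reachability dichotomy -/
theorem reach {V : Type*} [Fintype V] (G : SimpleGraph V) (s t : V) (R : V → V → Prop)
    (hR : ∀ x y, R x y → G.Adj x y) :
    (∃ p : G.Walk s t, p.IsPath ∧ ∀ e ∈ p.darts, R e.fst e.snd) ∨
    (∃ S : Finset V, s ∈ S ∧ t ∉ S ∧ ∀ x ∈ S, ∀ y, y ∉ S → ¬ R x y) := by
  classical
  by_cases h : Relation.ReflTransGen R s t
  · left
    obtain ⟨p, hp⟩ : ∃ p : G.Walk s t, ∀ e ∈ p.darts, R e.fst e.snd := by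
      induction h using Relation.ReflTransGen.head_induction_on with
      | refl => exact ⟨.nil, by simp⟩
      | head h1 _ ih =>
        obtain ⟨p, hp⟩ := ih
        refine ⟨.cons (hR _ _ h1) p, ?_⟩
        intro e he
        simp only [Walk.darts_cons, List.mem_cons] at he
        rcases he with rfl | he
        · exact h1
        · exact hp e he
    exact ⟨p.bypass, p.bypass_isPath, fun e he => hp e (p.darts_bypass_subset_darts he)⟩
  · right
    refine ⟨univ.filter fun v => Relation.ReflTransGen R s v, ?_, by simpa using h, ?_⟩
    · simpa using Relation.ReflTransGen.refl
    · intro x hx y hy hxy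
      simp only [mem_filter, mem_univ, true_and] at hx hy
      exact hy (hx.tail hxy)

theorem exists_flow {V : Type*} [Fintype V] (G : SimpleGraph V) (s t : V) (hst : s ≠ t) (d : ℕ)
    (hcut : ∀ A : Finset V, s ∈ A → t ∉ A → d ≤ cut G A) (n : ℕ) (hn : n ≤ d) :
    ∃ f, Flow G s t f ∧ ∑ v, f s v = n := by
  classical
  induction n with
  | zero => exact ⟨fun _ _ => 0, ⟨by simp, by simp, by simp, by simp⟩, by simp⟩
  | succ n ih =>
    obtain ⟨f, hf, hv⟩ := ih (by omega)
    rcases reach G s t (fun x y => G.Adj x y ∧ f x y ≤ 0) (fun _ _ h => h.1) with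
      ⟨p, hp, hd⟩ | ⟨S, hs, ht, hS⟩
    · refine ⟨fun x y => f x y + pf p x y, ⟨?_, ?_, ?_, ?_⟩, ?_⟩
      · intro u v; rw [hf.anti u v, pf_anti p u v]; ring
      · intro u v
        have := hf.bd u v
        rcases pf_cases p hp.isTrail u v with h | ⟨h, e, he, rfl, rfl⟩
        · omega
        · have := (hd e he).2; omega
      · intro u v h
        show _ + _ = (0 : ℤ)
        rw [hf.supp u v h, pf_not_mem p u v (fun h' => h (p.adj_of_mem_edges h'))]; simp
      · intro u h1 h2
        rw [Finset.sum_add_distrib, hf.cons u h1 h2, pf_div]; simp [h1, h2]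
      · rw [Finset.sum_add_distrib, hv, pf_div]; simp [hst]
    · exfalso
      have h1 := flow_cut hf S hs ht
      have h2 : (cut G S : ℤ) = ∑ v, f s v := by
        rw [h1, cut, Finset.card_filter]
        push_cast
        refine Finset.sum_congr rfl fun p _ => ?_
        by_cases a : p.1 ∈ S <;> by_cases b : p.2 ∈ S <;> by_cases c : G.Adj p.1 p.2 <;>
          simp [a, b, c]
        · have := hS _ a _ b
          have h3 := hf.bd p.1 p.2
          have h4 : ¬ f p.1 p.2 ≤ 0 := fun h => this ⟨c, h⟩
          omega
        · exact (hf.supp _ _ c).symm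
      have h3 := hcut S hs ht
      omega

theorem decompose {V : Type*} [Fintype V] (G : SimpleGraph V) (s t : V) (hst : s ≠ t) (n : ℕ) :
    ∀ f, Flow G s t f → ∑ v, f s v = n → ∃ P : Fin n → G.Walk s t,
      (∀ i, (P i).IsPath) ∧ (∀ i j, i ≠ j → List.Disjoint (P i).edges (P j).edges) ∧
      ∀ i, ∀ e ∈ (P i).darts, f e.fst e.snd = 1 := by
  classical
  induction n with
  | zero => intro f _ _; exact ⟨fun i => i.elim0, fun i => i.elim0, fun i => i.elim0,
      fun i => i.elim0⟩
  | succ n ih =>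
    intro f hf hv
    rcases reach G s t (fun x y => G.Adj x y ∧ f x y = 1) (fun _ _ h => h.1) with
      ⟨p, hp, hd⟩ | ⟨S, hs, ht, hS⟩
    · obtain ⟨P, hP1, hP2, hP3⟩ := ih (fun x y => f x y - pf p x y) (by
        refine ⟨?_, ?_, ?_, ?_⟩
        · intro u v; rw [hf.anti u v, pf_anti p u v]; ring
        · intro u v
          have := hf.bd u v
          have h2 := pf_anti p u v
          rcases pf_cases p hp.isTrail v u with h | ⟨h, e, he, rfl, rfl⟩
          · omega
          · have := (hd e he).2
            have := hf.anti e.snd e.fst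
            omega
        · intro u v h
          show _ - _ = (0 : ℤ)
          rw [hf.supp u v h, pf_not_mem p u v (fun h' => h (p.adj_of_mem_edges h'))]; simp
        · intro u h1 h2
          rw [Finset.sum_sub_distrib, hf.cons u h1 h2, pf_div]; simp [h1, h2])
        (by rw [Finset.sum_sub_distrib, hv, pf_div]; simp [hst])
      have key : ∀ i, ∀ e ∈ (P i).darts, s(e.fst, e.snd) ∉ p.edges := by
        intro i e he hm
        have h1 := hP3 i e he
        rcases mem_edges_dart p _ _ hm with ⟨e', he', h2, h3⟩ | ⟨e', he', h2, h3⟩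
        · have h4 := pf_dart p hp.isTrail e' he'
          have h5 := (hd e' he').2
          rw [h2, h3] at h4 h5
          omega
        · have h4 := pf_dart p hp.isTrail e' he'
          have h5 := (hd e' he').2
          rw [h2, h3] at h4 h5
          have h6 := pf_anti p e.fst e.snd
          have h7 := hf.anti e.fst e.snd
          omega
      have key2 : ∀ i, List.Disjoint (P i).edges p.edges := by
        intro i e he hep
        rw [Walk.edges, List.mem_map] at he
        obtain ⟨e', he', rfl⟩ := he
        exact key i e' he' hep
      refine ⟨Fin.cons p P, ?_, ?_, ?_⟩
      · intro i
        refine Fin.cases ?_ (fun i => ?_) i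
        · simpa using hp
        · simpa using hP1 i
      · intro i j
        refine Fin.cases ?_ (fun i => ?_) i <;> refine Fin.cases ?_ (fun j => ?_) j
        · simp
        · intro _; simpa using (key2 j).symm
        · intro _; simpa using key2 i
        · intro h; simpa using hP2 i j (fun h' => h (by rw [h']))
      · intro i
        refine Fin.cases ?_ (fun i => ?_) i
        · intro e he; exact (hd e (by simpa using he)).2
        · intro e he
          have he' : e ∈ (P i).darts := by simpa using he
          have h1 := hP3 i e he'
          rw [pf_not_mem p _ _ (key i e he')] at h1
          simpa using h1
    · exfalso
      have h1 := flow_cut hf S hs ht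
      have h2 : ∑ v, f s v ≤ 0 := by
        rw [h1]
        refine Finset.sum_nonpos fun p _ => ?_
        split_ifs with h
        · by_cases c : G.Adj p.1 p.2
          · have h3 := hf.bd p.1 p.2
            have h4 : ¬ f p.1 p.2 = 1 := fun h' => hS _ h.1 _ h.2 ⟨c, h'⟩
            omega
          · rw [hf.supp _ _ c]
        · exact le_rfl
      omega

/-- edge version of the Menger theorem -/
theorem menger {V : Type*} [Fintype V] (G : SimpleGraph V) (s t : V) (hst : s ≠ t) (d : ℕ)
    (hcut : ∀ A : Finset V, s ∈ A → t ∉ A → d ≤ cut G A) :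
    ∃ P : Fin d → G.Walk s t,
      (∀ i, (P i).IsPath) ∧ ∀ i j, i ≠ j → List.Disjoint (P i).edges (P j).edges := by
  obtain ⟨f, hf, hv⟩ := exists_flow G s t hst d hcut d le_rfl
  obtain ⟨P, h1, h2, -⟩ := decompose G s t hst d f hf hv
  exact ⟨P, h1, h2⟩

/-- `A` is a minimum cut separating two vertices of degree `d` -/
def MinCut {V : Type*} [Fintype V] (G : SimpleGraph V) (s t : V) (A : Finset V) : Prop :=
  s ∈ A ∧ t ∉ A ∧ ∀ B : Finset V, s ∈ B → t ∉ B → cut G A ≤ cut G B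

theorem exists_minCut {V : Type*} [Fintype V] (G : SimpleGraph V) (s t : V) (h : s ≠ t) :
    ∃ A, MinCut G s t A := by
  classical
  obtain ⟨A, hA, hm⟩ := Finset.exists_min_image
    (univ.filter fun A : Finset V => s ∈ A ∧ t ∉ A) (cut G) ⟨{s}, by simpa using h.symm⟩
  simp only [mem_filter, mem_univ, true_and] at hA hm
  exact ⟨A, hA.1, hA.2, fun B h1 h2 => hm B ⟨h1, h2⟩⟩

open Classical in
theorem uncross {V : Type*} [Fintype V] (G : SimpleGraph V) (s t u v : V) (A X : Finset V)
    (hA : MinCut G s t A) (hX : MinCut G u v X) (hu : u ∈ A) (ht : t ∉ X) :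
    MinCut G u v (A ∩ X) := by
  refine ⟨Finset.mem_inter.2 ⟨hu, hX.1⟩, fun h => hX.2.1 (Finset.mem_inter.1 h).2, ?_⟩
  intro B h1 h2
  have h3 := cut_submod G A X
  have h4 := hA.2.2 (A ∪ X) (Finset.mem_union_left _ hA.1) (by
    intro h; rcases Finset.mem_union.1 h with h | h
    · exact hA.2.1 h
    · exact ht h)
  have h5 := hX.2.2 B h1 h2
  omega

open Classical in
theorem minCut_compl {V : Type*} [Fintype V] (G : SimpleGraph V) (u v : V)
    (X : Finset V) (hX : MinCut G u v X) : MinCut G v u Xᶜ := by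
  refine ⟨by simpa using hX.2.1, by simpa using hX.1, fun B h1 h2 => ?_⟩
  have h3 := cut_compl G X
  have h4 := cut_compl G B
  have h5 := hX.2.2 Bᶜ (by simpa using h2) (by simpa using h1)
  omega

theorem exists_leaf {V : Type*} [Fintype V] (G : SimpleGraph V) (T : Set V) (a b : V)
    (ha : a ∈ T) (hb : b ∈ T) (hab : a ≠ b) :
    ∃ A s t, s ∈ T ∧ t ∈ T ∧ MinCut G s t A ∧ ∀ u ∈ A, u ∈ T → u = s := by
  classical
  have hne : (univ.filter fun A : Finset V => ∃ s ∈ T, ∃ t ∈ T, MinCut G s t A).Nonempty := by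
    obtain ⟨A, hA⟩ := exists_minCut G a b hab
    exact ⟨A, by simpa using ⟨a, ha, b, hb, hA⟩⟩
  obtain ⟨A, hA, hmin⟩ := Finset.exists_min_image _ Finset.card hne
  simp only [mem_filter, mem_univ, true_and] at hA hmin
  obtain ⟨s, hs, t, ht, hA⟩ := hA
  refine ⟨A, s, t, hs, ht, hA, ?_⟩
  have key : ∀ u v X, u ∈ T → v ∈ T → u ∈ A → v ∈ A → MinCut G u v X → t ∉ X → False := by
    intro u v X hu hv huA hvA hX htX
    have h1 := uncross G s t u v A X hA hX huA htX
    have h2 := hmin _ ⟨u, hu, v, hv, h1⟩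
    have h3 : (A ∩ X).card < A.card := by
      apply Finset.card_lt_card
      rw [Finset.ssubset_iff_of_subset Finset.inter_subset_left]
      exact ⟨v, hvA, h1.2.1⟩
    omega
  intro u hu huT
  by_contra hus
  obtain ⟨X, hX⟩ := exists_minCut G u s hus
  by_cases htX : t ∈ X
  · exact key s u Xᶜ hs huT hA.1 hu (minCut_compl G u s X hX) (by simpa using htX)
  · exact key u s X huT hs hu hA.1 hX htX

theorem leaf_cut {V : Type*} [Fintype V] (G : SimpleGraph V) (d : ℕ) (A : Finset V) (s : V)
    (hs : s ∈ A) (hd : dg G s = d) (hu : ∀ u ∈ A, dg G u = d → u = s)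
    (hval : ∀ v w, G.Adj v w → ∃ a b, a ≠ b ∧ G.Adj v a ∧ G.Adj v b ∧ dg G a = d ∧ dg G b = d) :
    d ≤ cut G A := by
  classical
  have h1 : ∀ v, G.Adj s v → ∃ w, w ∉ A ∧ G.Adj v w := by
    intro v hv
    obtain ⟨a, b, hab, h1, h2, h3, h4⟩ := hval v s hv.symm
    by_cases ha : a ∈ A
    · refine ⟨b, fun hb => hab ?_, h2⟩
      rw [hu a ha h3, hu b hb h4]
    · exact ⟨a, ha, h1⟩
  choose! w hw1 hw2 using h1
  rw [← hd, dg_eq, cut]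
  apply Finset.card_le_card_of_injOn (fun v => if v ∈ A then (v, w v) else (s, v))
  · intro v hv
    replace hv : G.Adj s v := (Finset.mem_filter.1 hv).2
    by_cases hvA : v ∈ A
    · simp [hvA, hw1 v hv, hw2 v hv]
    · simp [hvA, hs, hv]
  · intro v hv v' hv' h
    replace hv : G.Adj s v := (Finset.mem_filter.1 hv).2
    replace hv' : G.Adj s v' := (Finset.mem_filter.1 hv').2
    by_cases hvA : v ∈ A <;> by_cases hvA' : v' ∈ A <;> simp [hvA, hvA'] at h
    · exact h.1
    · exact absurd h.1 hv.ne'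
    · exact absurd h.1 hv'.ne
    · exact h

/-- Main argument for a critical graph. -/
theorem critical {V : Type*} [Fintype V] (H : SimpleGraph V) (d : ℕ) (v₀ w₀ : V)
    (h₀ : H.Adj v₀ w₀)
    (hval : ∀ v w, H.Adj v w → ∃ a b, a ≠ b ∧ H.Adj v a ∧ H.Adj v b ∧ dg H a = d ∧ dg H b = d) :
    ∃ x y : V, x ≠ y ∧ ∃ P : Fin d → H.Walk x y,
      (∀ i, (P i).IsPath) ∧ ∀ i j, i ≠ j → List.Disjoint (P i).edges (P j).edges := by
  obtain ⟨a, b, hab, -, -, ha, hb⟩ := hval v₀ w₀ h₀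
  obtain ⟨A, s, t, hs, ht, hA, hu⟩ := exists_leaf H {v | dg H v = d} a b ha hb hab
  have hst : s ≠ t := by rintro rfl; exact hA.2.1 hA.1
  have hc := leaf_cut H d A s hA.1 hs hu hval
  exact ⟨s, t, hst, menger H s t hst d fun B h1 h2 => hc.trans (hA.2.2 B h1 h2)⟩

theorem dg_mono {V : Type*} [Fintype V] {H G : SimpleGraph V} (h : H ≤ G) (v : V) :
    dg H v ≤ dg G v := by
  classical
  rw [dg_eq, dg_eq]
  exact Finset.card_le_card fun a ha => by
    simp only [mem_filter, mem_univ, true_and] at ha ⊢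
    exact h ha

end EDP

/-- Thomassen: every simple graph with maximum degree `d` and chromatic index `d + 1`
contains two vertices `x, y` and `d` pairwise edge-disjoint paths between `x` and `y`. -/
theorem statement0 {V : Type*} [Fintype V] (G : SimpleGraph V) [DecidableRel G.Adj] (d : ℕ)
    (hmax : G.maxDegree = d)
    (hub : EdgeColorable G (d + 1)) (hlb : ¬ EdgeColorable G d) :
    ∃ x y : V, x ≠ y ∧ ∃ P : Fin d → G.Walk x y,
      (∀ i, (P i).IsPath) ∧
      ∀ i j, i ≠ j → List.Disjoint (P i).edges (P j).edges := by
  classical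
  have hdG : ∀ v, EDP.dg G v ≤ d := by
    intro v; rw [EDP.dg_eq_degree, ← hmax]; exact G.degree_le_maxDegree v
  have hGn : ¬ ∃ c : Sym2 V → Fin d, EDP.Proper G c := by
    rintro ⟨c, hc⟩
    refine hlb ⟨fun e => c e, ?_⟩
    rintro ⟨e, he⟩ ⟨f, hf⟩ hne ⟨v, hve, hvf⟩
    obtain ⟨a, rfl⟩ := hve
    obtain ⟨b, rfl⟩ := hvf
    exact hc v a b he hf (by rintro rfl; exact hne rfl)
  obtain ⟨a₀, b₀, hab₀⟩ : ∃ a b, G.Adj a b := by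
    by_contra hno
    push Not at hno
    refine hlb ⟨fun e => ?_, fun e => ?_⟩
    · exact absurd e.2 (Sym2.ind (fun a b => hno a b) e.1)
    · exact absurd e.2 (Sym2.ind (fun a b => hno a b) e.1)
  have hdpos : 0 < d := by
    have h1 := hdG a₀
    rw [EDP.dg_eq] at h1
    exact (Finset.card_pos.2 ⟨b₀, by simpa using hab₀⟩).trans_le h1
  obtain ⟨H, ⟨hHG, hHn⟩, hHmin⟩ := (Set.toFinite
    {H : SimpleGraph V | H ≤ G ∧ ¬ ∃ c : Sym2 V → Fin d, EDP.Proper H c}).exists_minimal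
      ⟨G, le_rfl, hGn⟩
  have hdH : ∀ v, EDP.dg H v ≤ d := fun v => (EDP.dg_mono hHG v).trans (hdG v)
  have hval : ∀ v w, H.Adj v w → ∃ a b, a ≠ b ∧ H.Adj v a ∧ H.Adj v b ∧
      EDP.dg H a = d ∧ EDP.dg H b = d := by
    intro v w hvw
    have hcol : ∃ c : Sym2 V → Fin d, EDP.Proper (H.deleteIncidenceSet v) c := by
      by_contra hno
      have := hHmin (y := H.deleteIncidenceSet v)
        ⟨(H.deleteIncidenceSet_le v).trans hHG, hno⟩ (H.deleteIncidenceSet_le v)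
      have h2 := this hvw
      simp [deleteIncidenceSet_adj] at h2
    obtain ⟨c, hc⟩ := hcol
    by_contra hno
    push Not at hno
    by_cases hex : ∃ a, H.Adj v a ∧ EDP.dg H a = d
    · obtain ⟨a, ha, had⟩ := hex
      refine hHn (EDP.extend d H hdH v a (fun u hu hud => ?_) c hc)
      by_contra hua
      exact hno u a hua hu ha hud had
    · push Not at hex
      exact hHn (EDP.extend d H hdH v v (fun u hu hud => absurd hud (hex u hu)) c hc)
  obtain ⟨v₀, w₀, h₀⟩ : ∃ v w, H.Adj v w := by
    by_contra hno
    push Not at hno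
    exact hHn ⟨fun _ => ⟨0, hdpos⟩, fun u a b ha => absurd ha (hno u a)⟩
  obtain ⟨x, y, hxy, P, hP, hPd⟩ := EDP.critical H d v₀ w₀ h₀ hval
  refine ⟨x, y, hxy, fun i => (P i).mapLe hHG, fun i => ?_, fun i j hij => ?_⟩
  · exact (Walk.isPath_mapLe hHG).2 (hP i)
  · simpa [Walk.edges_mapLe_eq_edges] using hPd i j hij
end

section
/- If G is the line graph of a simple graph, then G contains a totally odd strong immersion of the complete graph on χ(G) vertices. -/
open SimpleGraph

/-- `G` contains a totally odd strong immersion of the complete graph `K t`: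
pairwise edge-disjoint odd paths joining the terminals, and no terminal appears
as an interior vertex of any of the paths. -/
def TotallyOddStrongCliqueImmersion {V : Type*} (G : SimpleGraph V) (t : ℕ) : Prop :=
  ∃ φ : Fin t ↪ V, ∃ P : (i j : Fin t) → G.Walk (φ i) (φ j),
    (∀ i j : Fin t, i < j → (P i j).IsPath) ∧
    (∀ i j : Fin t, i < j → Odd (P i j).length) ∧
    (∀ i j k : Fin t, i < j → φ k ∈ (P i j).support → k = i ∨ k = j) ∧
    (∀ i j i' j' : Fin t, i < j → i' < j' → (i, j) ≠ (i', j') →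
      List.Disjoint (P i j).edges (P i' j').edges)

open SimpleGraph

section Kempe
open Classical

namespace TOI

variable {V : Type*} 

/-- proper edge colouring with colours in `K` -/
def IsEC (G : SimpleGraph V) (K : Finset ℕ) (c : Sym2 V → ℕ) : Prop :=
  (∀ a b, G.Adj a b → c s(a, b) ∈ K) ∧
  ∀ a b b', G.Adj a b → G.Adj a b' → b ≠ b' → c s(a, b) ≠ c s(a, b')

def EC (G : SimpleGraph V) (K : Finset ℕ) : Prop := ∃ c, IsEC G K c

def Miss (G : SimpleGraph V) (c : Sym2 V → ℕ) (u : V) (i : ℕ) : Prop :=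
  ∀ b, G.Adj u b → c s(u, b) ≠ i

def KG (G : SimpleGraph V) (c : Sym2 V → ℕ) (i j : ℕ) : SimpleGraph V where
  Adj a b := G.Adj a b ∧ (c s(a, b) = i ∨ c s(a, b) = j)
  symm := ⟨fun a b h => by rw [Sym2.eq_swap]; exact ⟨h.1.symm, h.2⟩⟩
  loopless := ⟨fun a h => G.loopless.irrefl a h.1⟩

noncomputable def kswap (G : SimpleGraph V) (c : Sym2 V → ℕ) (i j : ℕ) (w : V) : Sym2 V → ℕ :=
  fun e => if ∃ a ∈ e, (KG G c i j).Reachable w a then Equiv.swap i j (c e) else c e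

variable {G : SimpleGraph V} {K : Finset ℕ} {c : Sym2 V → ℕ} {i j : ℕ} {w : V}

lemma kswap_in {a : V} (h : (KG G c i j).Reachable w a) (b : V) :
    kswap G c i j w s(a, b) = Equiv.swap i j (c s(a, b)) := by
  unfold kswap
  rw [if_pos ⟨a, by simp, h⟩]

lemma kswap_out {a : V} (h : ¬ (KG G c i j).Reachable w a) {b : V} (hab : G.Adj a b) :
    kswap G c i j w s(a, b) = c s(a, b) := by
  unfold kswap
  split_ifs with h1
  · obtain ⟨x, hx, hr⟩ := h1
    rw [Sym2.mem_iff] at hx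
    rcases hx with rfl | rfl
    · exact absurd hr h
    · apply Equiv.swap_apply_of_ne_of_ne
      · intro hc
        apply h
        apply hr.trans
        apply Adj.reachable
        refine ⟨hab.symm, ?_⟩
        rw [Sym2.eq_swap]; exact Or.inl hc
      · intro hc
        apply h
        apply hr.trans
        apply Adj.reachable
        refine ⟨hab.symm, ?_⟩
        rw [Sym2.eq_swap]; exact Or.inr hc
  · rfl

lemma kswap_isEC (hc : IsEC G K c) (hi : i ∈ K) (hj : j ∈ K) :
    IsEC G K (kswap G c i j w) := by
  constructor
  · intro a b hab
    by_cases h : (KG G c i j).Reachable w a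
    · rw [kswap_in h]
      have := hc.1 a b hab
      rw [Equiv.swap_apply_def]
      split_ifs <;> assumption
    · rw [kswap_out h hab]; exact hc.1 a b hab
  · intro a b b' hab hab' hbb
    by_cases h : (KG G c i j).Reachable w a
    · rw [kswap_in h, kswap_in h]
      intro h2
      exact hc.2 a b b' hab hab' hbb ((Equiv.swap i j).injective h2)
    · rw [kswap_out h hab, kswap_out h hab']; exact hc.2 a b b' hab hab' hbb

lemma kswap_miss_in {a : V} (h : (KG G c i j).Reachable w a) (x : ℕ) :
    Miss G (kswap G c i j w) a x ↔ Miss G c a (Equiv.swap i j x) := by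
  unfold Miss
  refine forall_congr' fun b => forall_congr' fun hab => ?_
  rw [kswap_in h, not_iff_not]
  constructor
  · rintro rfl; simp
  · intro h; rw [h]; simp

lemma kswap_miss_out {a : V} (h : ¬ (KG G c i j).Reachable w a) (x : ℕ) :
    Miss G (kswap G c i j w) a x ↔ Miss G c a x := by
  unfold Miss
  refine forall_congr' fun b => forall_congr' fun hab => ?_
  rw [kswap_out h hab]

lemma three_ends {W : Type*} [Fintype W] (F : SimpleGraph W) (hF : F.Connected)
    (h2 : ∀ a, F.degree a ≤ 2) (a b d : W) (hab : a ≠ b) (had : a ≠ d) (hbd : b ≠ d)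
    (ha : F.degree a ≤ 1) (hb : F.degree b ≤ 1) (hd : F.degree d ≤ 1) : False := by
  have h1 := hF.card_vert_le_card_edgeSet_add_one
  have h3 := F.sum_degrees_eq_twice_card_edges
  have h4 : ∑ v, (F.degree v + if v = a ∨ v = b ∨ v = d then 1 else 0) ≤ ∑ v : W, 2 := by
    apply Finset.sum_le_sum
    intro v _
    have := h2 v
    split_ifs with h
    · rcases h with rfl | rfl | rfl <;> omega
    · omega
  rw [Finset.sum_add_distrib, h3, ← Finset.card_filter] at h4
  have h5 : Finset.univ.filter (fun v => v = a ∨ v = b ∨ v = d) = {a, b, d} := by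
    ext v; simp
  rw [h5, Finset.card_eq_three.2 ⟨a, b, d, hab, had, hbd, rfl⟩] at h4
  simp at h4
  rw [Nat.card_eq_fintype_card, Nat.card_eq_fintype_card, ← edgeFinset_card] at h1
  omega

lemma kempe_ends [Fintype V] (hc : IsEC G K c) (a b d : V)
    (hab : a ≠ b) (had : a ≠ d) (hbd : b ≠ d)
    (ra : (KG G c i j).Reachable w a) (rb : (KG G c i j).Reachable w b)
    (rd : (KG G c i j).Reachable w d)
    (ha : Miss G c a i ∨ Miss G c a j) (hb : Miss G c b i ∨ Miss G c b j)
    (hd : Miss G c d i ∨ Miss G c d j) : False := by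
  let C := (KG G c i j).connectedComponentMk w
  have mem : ∀ x, (KG G c i j).Reachable w x → x ∈ C.supp := by
    intro x hx
    rw [ConnectedComponent.mem_supp_iff]
    exact ConnectedComponent.sound hx.symm
  have key : ∀ (S : Finset ℕ) (x : C.supp), (∀ y, (KG G c i j).Adj x y → c s(x.1, y) ∈ S) →
      (C.toSimpleGraph).degree x ≤ S.card := by
    intro S x hx
    rw [← card_neighborFinset_eq_degree]
    apply Finset.card_le_card_of_injOn (fun y => c s(x.1, y.1))
    · intro y hy
      simp only [Finset.mem_coe, mem_neighborFinset] at hy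
      exact hx _ hy
    · intro y hy z hz hyz
      simp only [Finset.mem_coe, mem_neighborFinset] at hy hz
      by_contra hne
      have hy' : (KG G c i j).Adj x.1 y.1 := hy
      have hz' : (KG G c i j).Adj x.1 z.1 := hz
      exact hc.2 x y z hy'.1 hz'.1 (fun h => hne (Subtype.ext h)) hyz
  have key1 : ∀ (x : C.supp), (Miss G c x i ∨ Miss G c x j) → (C.toSimpleGraph).degree x ≤ 1 := by
    rintro x (h | h)
    · apply key {j} x
      intro y hy
      rcases hy.2 with h1 | h1
      · exact absurd h1 (h y hy.1)
      · simp [h1]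
    · apply key {i} x
      intro y hy
      rcases hy.2 with h1 | h1
      · simp [h1]
      · exact absurd h1 (h y hy.1)
  refine three_ends C.toSimpleGraph C.connected_toSimpleGraph ?_ ⟨a, mem a ra⟩ ⟨b, mem b rb⟩
    ⟨d, mem d rd⟩ (by simpa using hab) (by simpa using had) (by simpa using hbd)
    (key1 _ ha) (key1 _ hb) (key1 _ hd)
  intro x
  refine (key {i, j} x ?_).trans (Finset.card_le_two)
  intro y hy
  simpa using hy.2

end TOI
end Kempe

open SimpleGraph

section EFK
open Classical
set_option linter.unusedSectionVars false
set_option linter.unusedVariables false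

namespace TOI

variable {V : Type*} [Fintype V]

noncomputable def dg (G : SimpleGraph V) (u : V) : ℕ := (Finset.univ.filter (G.Adj u)).card

def delV (G : SimpleGraph V) (v : V) : SimpleGraph V where
  Adj a b := G.Adj a b ∧ a ≠ v ∧ b ≠ v
  symm := ⟨fun a b h => ⟨h.1.symm, h.2.2, h.2.1⟩⟩
  loopless := ⟨fun a h => G.loopless.irrefl a h.1⟩

lemma dg_mono {G G' : SimpleGraph V} (u : V) (h : ∀ b, G'.Adj u b → G.Adj u b) :
    dg G' u ≤ dg G u := by
  apply Finset.card_le_card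
  intro b; simp; exact h b

lemma dg_lt {G G' : SimpleGraph V} (u x : V) (h : ∀ b, G'.Adj u b → G.Adj u b)
    (hx : G.Adj u x) (hx' : ¬ G'.Adj u x) : dg G' u < dg G u := by
  apply Finset.card_lt_card
  rw [Finset.ssubset_iff_of_subset]
  · exact ⟨x, by simpa using hx, by simpa using hx'⟩
  · intro b; simp; exact h b

lemma dg_eq_succ {G G' : SimpleGraph V} (u x : V) (h : ∀ b, G'.Adj u b ↔ G.Adj u b ∧ b ≠ x)
    (hx : G.Adj u x) : dg G u = dg G' u + 1 := by
  unfold dg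
  have : Finset.univ.filter (G'.Adj u) = (Finset.univ.filter (G.Adj u)).erase x := by
    ext b; simp [h]; tauto
  rw [this, Finset.card_erase_of_mem (by simpa using hx)]
  have : 0 < (Finset.univ.filter (G.Adj u)).card := Finset.card_pos.2 ⟨x, by simpa using hx⟩
  omega

lemma dg_delV {G : SimpleGraph V} {u v : V} (h : G.Adj v u) : dg G u = dg (delV G v) u + 1 := by
  apply dg_eq_succ u v _ h.symm
  intro b
  constructor
  · intro hb; exact ⟨hb.1, hb.2.2⟩
  · intro hb; exact ⟨hb.1, h.ne', hb.2⟩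

lemma miss_card {D : SimpleGraph V} {K : Finset ℕ} {c : Sym2 V → ℕ} (hc : IsEC D K c) (u : V) :
    dg D u + (K.filter (Miss D c u)).card = K.card := by
  rw [← Finset.card_filter_add_card_filter_not (s := K) (Miss D c u), add_comm]
  congr 1
  unfold dg
  apply Finset.card_bij (fun b _ => c s(u, b))
  · intro b hb
    simp only [Finset.mem_filter, Finset.mem_univ, true_and] at hb
    simp only [Finset.mem_filter]
    refine ⟨hc.1 _ _ hb, fun h => h b hb rfl⟩
  · intro b hb b' hb' h
    simp only [Finset.mem_filter, Finset.mem_univ, true_and] at hb hb'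
    by_contra hne
    exact hc.2 u b b' hb hb' hne h
  · intro x hx
    simp only [Finset.mem_filter, Miss, not_forall, not_not] at hx
    obtain ⟨_, b, hb, h⟩ := hx
    exact ⟨b, by simpa using hb, h⟩

/-- choice of missing colours -/
def Good (D : SimpleGraph V) (N : Finset V) (u0 : V) (K : Finset ℕ) (c : Sym2 V → ℕ)
    (A : V → Finset ℕ) : Prop :=
  IsEC D K c ∧ ∀ u ∈ N, A u ⊆ K.filter (Miss D c u) ∧ (A u).card = if u = u0 then 1 else 2

noncomputable def XX (N : Finset V) (A : V → Finset ℕ) (i : ℕ) : Finset V :=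
  N.filter (fun u => i ∈ A u)

noncomputable def pot (N : Finset V) (K : Finset ℕ) (A : V → Finset ℕ) : ℕ :=
  ∑ i ∈ K, (XX N A i).card ^ 2

lemma sum_XX (D : SimpleGraph V) (N : Finset V) (u0 : V) (hu0 : u0 ∈ N) (K : Finset ℕ)
    (c : Sym2 V → ℕ) (A : V → Finset ℕ) (h : Good D N u0 K c A) :
    ∑ i ∈ K, (XX N A i).card + 1 = 2 * N.card := by
  have h1 : ∑ i ∈ K, (XX N A i).card = ∑ u ∈ N, (A u).card := by
    unfold XX
    simp_rw [Finset.card_filter]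
    rw [Finset.sum_comm]
    apply Finset.sum_congr rfl
    intro u hu
    rw [← Finset.card_filter]
    congr 1
    ext x
    simp only [Finset.mem_filter, and_iff_right_iff_imp]
    intro hx
    exact (Finset.mem_filter.1 ((h.2 u hu).1 hx)).1
  rw [h1, Finset.sum_congr rfl (fun u hu => (h.2 u hu).2), ← Finset.add_sum_erase N _ hu0]
  have : ∑ x ∈ N.erase u0, (if x = u0 then 1 else 2) = ∑ x ∈ N.erase u0, 2 := by
    apply Finset.sum_congr rfl
    intro x hx
    rw [if_neg (Finset.ne_of_mem_erase hx)]
  rw [this]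
  simp [Finset.card_erase_of_mem hu0]
  have : 0 < N.card := Finset.card_pos.2 ⟨u0, hu0⟩
  omega

lemma improve (D : SimpleGraph V) (N : Finset V) (u0 : V) (K : Finset ℕ)
    (c : Sym2 V → ℕ) (A : V → Finset ℕ) (h : Good D N u0 K c A) (i j : ℕ) (hi : i ∈ K) (hj : j ∈ K)
    (hXi : (XX N A i).card = 0) (hXj : 3 ≤ (XX N A j).card) :
    ∃ c' A', Good D N u0 K c' A' ∧ pot N K A' < pot N K A := by
  have hij : i ≠ j := by rintro rfl; omega
  obtain ⟨w, hw⟩ : (XX N A j).Nonempty := Finset.card_pos.1 (by omega)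
  set R := (KG D c i j).Reachable w with hR
  let A' : V → Finset ℕ := fun u => if R u then (A u).image (Equiv.swap i j) else A u
  have hiA : ∀ u ∈ N, i ∉ A u := by
    intro u hu hiu
    rw [Finset.card_eq_zero] at hXi
    have : u ∈ XX N A i := Finset.mem_filter.2 ⟨hu, hiu⟩
    rw [hXi] at this; simp at this
  refine ⟨kswap D c i j w, A', ⟨kswap_isEC h.1 hi hj, ?_⟩, ?_⟩
  · intro u hu
    obtain ⟨h1, h2⟩ := h.2 u hu
    by_cases hr : R u
    · simp only [A', if_pos hr]
      constructor
      · intro x hx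
        rw [Finset.mem_image] at hx
        obtain ⟨y, hy, rfl⟩ := hx
        have := h1 hy
        rw [Finset.mem_filter] at this ⊢
        constructor
        · rw [Equiv.swap_apply_def]
          split_ifs
          · exact hj
          · exact hi
          · exact this.1
        · rw [kswap_miss_in hr]; simpa using this.2
      · rw [Finset.card_image_of_injective _ (Equiv.injective _), h2]
    · simp only [A', if_neg hr]
      refine ⟨?_, h2⟩
      intro x hx
      have := h1 hx
      rw [Finset.mem_filter] at this ⊢
      rw [kswap_miss_out hr]
      exact this
  · unfold pot
    have hjK : j ∈ K.erase i := Finset.mem_erase.2 ⟨hij.symm, hj⟩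
    rw [← Finset.add_sum_erase K _ hi, ← Finset.add_sum_erase (K.erase i) _ hjK,
      ← Finset.add_sum_erase K _ hi, ← Finset.add_sum_erase (K.erase i) _ hjK]
    have hrest : ∑ x ∈ (K.erase i).erase j, (XX N A' x).card ^ 2
        = ∑ x ∈ (K.erase i).erase j, (XX N A x).card ^ 2 := by
      apply Finset.sum_congr rfl
      intro x hx
      have hxj := Finset.ne_of_mem_erase hx
      have hxi := Finset.ne_of_mem_erase (Finset.mem_of_mem_erase hx)
      congr 2
      unfold XX
      apply Finset.filter_congr
      intro u hu
      by_cases hr : R u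
      · simp only [A', if_pos hr, Finset.mem_image]
        constructor
        · rintro ⟨y, hy, hyx⟩
          rw [Equiv.swap_apply_eq_iff, Equiv.swap_apply_of_ne_of_ne hxi hxj] at hyx
          rwa [← hyx]
        · intro hx; exact ⟨x, hx, Equiv.swap_apply_of_ne_of_ne hxi hxj⟩
      · simp only [A', if_neg hr]
    have hX'i : XX N A' i = (XX N A j).filter R := by
      unfold XX
      ext u
      simp only [Finset.mem_filter]
      by_cases hu : u ∈ N
      · by_cases hr : R u
        · simp only [A', if_pos hr, Finset.mem_image, hu, hr, true_and, and_true]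
          constructor
          · rintro ⟨y, hy, hyx⟩
            rw [Equiv.swap_apply_eq_iff] at hyx
            simp at hyx
            rwa [← hyx]
          · intro hx; exact ⟨j, hx, by simp⟩
        · simp only [A', if_neg hr, hr]
          simp [hiA u hu]
      · simp [hu]
    have hX'j : XX N A' j = (XX N A j).filter (fun u => ¬ R u) := by
      unfold XX
      ext u
      simp only [Finset.mem_filter]
      by_cases hu : u ∈ N
      · by_cases hr : R u
        · simp only [A', if_pos hr, Finset.mem_image, hu, hr, true_and, not_true, and_false, iff_false]
          rintro ⟨y, hy, hyx⟩
          rw [Equiv.swap_apply_eq_iff] at hyx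
          simp at hyx
          exact hiA u hu (hyx ▸ hy)
        · simp only [A', if_neg hr, hr]
          simp
      · simp [hu]
    have hsum := Finset.card_filter_add_card_filter_not (s := XX N A j) R
    have hs1 : 0 < ((XX N A j).filter R).card :=
      Finset.card_pos.2 ⟨w, Finset.mem_filter.2 ⟨hw, Reachable.refl w⟩⟩
    have hs2 : ((XX N A j).filter R).card ≤ 2 := by
      by_contra hcon
      push Not at hcon
      obtain ⟨x, y, z, hx, hy, hz, hxy, hxz, hyz⟩ := Finset.two_lt_card_iff.1 hcon
      have hm : ∀ u, u ∈ (XX N A j).filter R → Miss D c u i ∨ Miss D c u j := by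
        intro u hu
        have hu' := Finset.mem_filter.1 (Finset.mem_filter.1 hu).1
        exact Or.inr (Finset.mem_filter.1 ((h.2 u hu'.1).1 hu'.2)).2
      exact kempe_ends h.1 x y z hxy hxz hyz (Finset.mem_filter.1 hx).2 (Finset.mem_filter.1 hy).2
        (Finset.mem_filter.1 hz).2 (hm x hx) (hm y hy) (hm z hz)
    rw [hrest, hX'i, hX'j, hXi]
    generalize ((XX N A j).filter R).card = s at *
    generalize ((XX N A j).filter (fun u => ¬ R u)).card = r at *
    rw [← hsum]
    have : 0 < r := by omega
    nlinarith [Nat.mul_pos this hs1]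

lemma exists_single (D : SimpleGraph V) (N : Finset V) (u0 : V) (hu0 : u0 ∈ N) (K : Finset ℕ)
    (hN : N.card ≤ K.card) (hex : ∃ c A, Good D N u0 K c A) :
    ∃ c A i u, Good D N u0 K c A ∧ i ∈ K ∧ XX N A i = {u} := by
  have hP : ∃ m c A, Good D N u0 K c A ∧ pot N K A = m := by
    obtain ⟨c, A, h⟩ := hex
    exact ⟨_, c, A, h, rfl⟩
  obtain ⟨c, A, hg, hm⟩ := Nat.find_spec hP
  have hmin : ∀ c' A', Good D N u0 K c' A' → pot N K A ≤ pot N K A' := by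
    intro c' A' h'
    rw [hm]
    exact Nat.find_min' hP ⟨c', A', h', rfl⟩
  by_contra hcon
  push Not at hcon
  have hne : ∀ i ∈ K, (XX N A i).card ≠ 1 := by
    intro i hi h1
    obtain ⟨u, hu⟩ := Finset.card_eq_one.1 h1
    exact hcon c A i u hg hi hu
  have hs := sum_XX D N u0 hu0 K c A hg
  obtain ⟨i, hi, hXi⟩ : ∃ i ∈ K, (XX N A i).card = 0 := by
    by_contra h0
    push Not at h0
    have : ∑ i ∈ K, 2 ≤ ∑ i ∈ K, (XX N A i).card := by
      apply Finset.sum_le_sum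
      intro i hi
      have := hne i hi
      have := h0 i hi
      omega
    simp at this
    omega
  obtain ⟨j, hj, hXj⟩ : ∃ j ∈ K, Odd (XX N A j).card := by
    by_contra h0
    push Not at h0
    have : Even (∑ i ∈ K, (XX N A i).card) := by
      apply Finset.even_sum
      intro i hi
      simpa using h0 i hi
    obtain ⟨r, hr⟩ := this
    omega
  have h3 : 3 ≤ (XX N A j).card := by
    have := hne j hj
    obtain ⟨r, hr⟩ := hXj
    omega
  obtain ⟨c', A', h', hlt⟩ := improve D N u0 K c A hg i j hi hj hXi h3
  have := hmin c' A' h'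
  omega

theorem efk (n : ℕ) : ∀ (G : SimpleGraph V) (v u0 : V) (K : Finset ℕ), K.card = n → dg G v ≤ n →
    (∀ u, G.Adj v u → dg G u ≤ n) → (∀ u, G.Adj v u → u ≠ u0 → dg G u < n) →
    EC (delV G v) K → EC G K := by
  induction n with
  | zero =>
    intro G v u0 K hK hv _ _ hEC
    have h0 : ∀ b, ¬ G.Adj v b := by
      intro b hb
      have : 0 < dg G v := Finset.card_pos.2 ⟨b, by simpa using hb⟩
      omega
    have : delV G v = G := by
      ext a b
      constructor
      · intro h; exact h.1
      · intro h
        refine ⟨h, ?_, ?_⟩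
        · rintro rfl; exact h0 _ h
        · rintro rfl; exact h0 _ h.symm
    rwa [this] at hEC
  | succ n ih =>
    intro G v u0 K hK hv hle hlt hEC
    by_cases hN : ∃ b, G.Adj v b
    swap
    · push Not at hN
      have : delV G v = G := by
        ext a b
        constructor
        · intro h; exact h.1
        · intro h
          refine ⟨h, ?_, ?_⟩
          · rintro rfl; exact hN _ h
          · rintro rfl; exact hN _ h.symm
      rwa [this] at hEC
    obtain ⟨u1, hu1, hlt1⟩ : ∃ u1, G.Adj v u1 ∧ (∀ u, G.Adj v u → u ≠ u1 → dg G u < n + 1) := by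
      by_cases h : G.Adj v u0
      · exact ⟨u0, h, hlt⟩
      · obtain ⟨b, hb⟩ := hN
        refine ⟨b, hb, fun u hu _ => hlt u hu ?_⟩
        rintro rfl; exact h hu
    set D := delV G v with hD
    set N := Finset.univ.filter (G.Adj v) with hNdef
    have hex : ∃ c A, Good D N u1 K c A := by
      obtain ⟨c, hc⟩ := hEC
      have : ∀ u, ∃ B : Finset ℕ, u ∈ N → B ⊆ K.filter (Miss D c u) ∧
          B.card = if u = u1 then 1 else 2 := by
        intro u
        by_cases hu : u ∈ N
        · have hu' : G.Adj v u := by simpa [hNdef] using hu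
          have h1 := miss_card hc u
          have h2 := dg_delV hu'
          rw [← hD] at h2
          have : (if u = u1 then 1 else 2) ≤ (K.filter (Miss D c u)).card := by
            split_ifs with h
            · have := hle u hu'; omega
            · have := hlt1 u hu' h; omega
          obtain ⟨B, hB, hB'⟩ := Finset.exists_subset_card_eq this
          exact ⟨B, fun _ => ⟨hB, hB'⟩⟩
        · exact ⟨∅, fun h => absurd h hu⟩
      choose A hA using this
      exact ⟨c, A, hc, hA⟩
    obtain ⟨c, A, i, u, hg, hi, hX⟩ := exists_single D N u1 (by simpa [hNdef] using hu1) K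
      (by rw [hK]; exact hv) hex
    have huX : u ∈ XX N A i := by rw [hX]; simp
    have huN : u ∈ N := (Finset.mem_filter.1 huX).1
    have huv : G.Adj v u := by simpa [hNdef] using huN
    have hmu : Miss D c u i :=
      (Finset.mem_filter.1 ((hg.2 u huN).1 (Finset.mem_filter.1 huX).2)).2
    have hoth : ∀ x, G.Adj v x → x ≠ u → i ∉ A x := by
      intro x hx hxu hix
      have : x ∈ XX N A i := Finset.mem_filter.2 ⟨by simpa [hNdef] using hx, hix⟩
      rw [hX] at this; simp at this; exact hxu this
    let G' : SimpleGraph V :=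
      { Adj := fun a b => G.Adj a b ∧ s(a, b) ≠ s(v, u) ∧ (a = v ∨ b = v ∨ c s(a, b) ≠ i)
        symm := ⟨fun a b h => by
          have e : s(b, a) = s(a, b) := Sym2.eq_swap
          rw [e]; exact ⟨h.1.symm, h.2.1, by tauto⟩⟩
        loopless := ⟨fun a h => G.loopless.irrefl a h.1⟩ }
    have hG' : ∀ a b, G'.Adj a b ↔ G.Adj a b ∧ s(a, b) ≠ s(v, u) ∧ (a = v ∨ b = v ∨ c s(a, b) ≠ i) :=
      fun a b => Iff.rfl
    have hEC' : EC G' (K.erase i) := by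
      have hbound : ∀ x, G'.Adj v x → dg G' x + (if x = u1 then 0 else 1) ≤ n := by
        intro x hx
        have hx' := (hG' _ _).1 hx
        have hxu : x ≠ u := by rintro rfl; exact hx'.2.1 rfl
        have hmono : ∀ b, G'.Adj x b → G.Adj x b := fun b hb => hb.1
        by_cases hmx : Miss D c x i
        · have hxN : x ∈ N := by simpa [hNdef] using hx'.1
          have h1 := miss_card hg.1 x
          have h2 := dg_delV hx'.1
          rw [← hD] at h2
          have h3 : insert i (A x) ⊆ K.filter (Miss D c x) := by
            intro y hy
            rw [Finset.mem_insert] at hy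
            rcases hy with rfl | hy
            · exact Finset.mem_filter.2 ⟨hi, hmx⟩
            · exact (hg.2 x hxN).1 hy
          have h4 := Finset.card_le_card h3
          rw [Finset.card_insert_of_notMem (hoth x hx'.1 hxu), (hg.2 x hxN).2] at h4
          have h5 := dg_mono x hmono
          split_ifs at h4 ⊢ <;> omega
        · simp only [Miss, not_forall, not_not] at hmx
          obtain ⟨b, hb, hbi⟩ := hmx
          have h6 : dg G' x < dg G x := by
            apply dg_lt x b hmono hb.1
            intro h
            rcases h.2.2 with h | h | h
            · exact hb.2.1 h
            · exact hb.2.2 h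
            · exact h hbi
          have h7 := hle x hx'.1
          split_ifs with h
          · omega
          · have := hlt1 x hx'.1 h; omega
      apply ih G' v u1 (K.erase i)
      · rw [Finset.card_erase_of_mem hi, hK]; rfl
      · have : dg G' v < dg G v := dg_lt v u (fun b hb => hb.1) huv (fun h => h.2.1 rfl)
        omega
      · intro x hx; have := hbound x hx; omega
      · intro x hx hne; have := hbound x hx; rw [if_neg hne] at this; omega
      · refine ⟨c, ?_, ?_⟩
        · intro a b hab
          rw [Finset.mem_erase]
          have hD' : D.Adj a b := ⟨hab.1.1, hab.2⟩
          refine ⟨?_, hg.1.1 a b hD'⟩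
          have := hab.1.2.2
          have := hab.2
          tauto
        · intro a b b' hab hab' hne
          exact hg.1.2 a b b' ⟨hab.1.1, hab.2⟩ ⟨hab'.1.1, hab'.2⟩ hne
    obtain ⟨c', hc'⟩ := hEC'
    have hnot : ∀ a b, G.Adj a b → ¬ G'.Adj a b → s(a, b) = s(v, u) ∨ (D.Adj a b ∧ c s(a, b) = i) := by
      intro a b hab h
      rw [hG'] at h
      by_cases h1 : s(a, b) = s(v, u)
      · exact Or.inl h1
      · right
        refine ⟨⟨hab, ?_, ?_⟩, ?_⟩ <;> tauto
    refine ⟨fun e => if e ∈ G'.edgeSet then c' e else i, ?_, ?_⟩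
    · intro a b hab
      simp only [mem_edgeSet]
      split_ifs with h
      · exact Finset.mem_of_mem_erase (hc'.1 a b h)
      · exact hi
    · intro a b b' hab hab' hne
      simp only [mem_edgeSet]
      split_ifs with h h' h'
      · exact hc'.2 a b b' h h' hne
      · exact Finset.ne_of_mem_erase (hc'.1 a b h)
      · exact (Finset.ne_of_mem_erase (hc'.1 a b' h')).symm
      · exfalso
        have key : ∀ x y, s(a, x) = s(v, u) → D.Adj a y → c s(a, y) = i → False := by
          intro x y hx hy hyi
          rw [Sym2.eq_iff] at hx
          rcases hx with ⟨rfl, rfl⟩ | ⟨rfl, rfl⟩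
          · exact hy.2.1 rfl
          · exact hmu y hy hyi
        rcases hnot a b hab h with h1 | h1 <;> rcases hnot a b' hab' h' with h2 | h2
        · rw [← h2] at h1
          exact hne (Sym2.congr_right.1 h1)
        · exact key b b' h1 h2.1 h2.2
        · exact key b' b h2 h1.1 h1.2
        · exact hg.1.2 a b b' h1.1 h2.1 hne (h1.2.trans h2.2.symm)

end TOI
end EFK

open SimpleGraph

section Crit
open Classical
set_option linter.unusedSectionVars false
set_option linter.unusedVariables false

namespace TOI

variable {V : Type*} [Fintype V]

lemma EC.colorable {H : SimpleGraph V} {k : ℕ} (h : EC H (Finset.range k)) :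
    H.lineGraph.Colorable k := by
  obtain ⟨c, h1, h2⟩ := h
  have hm : ∀ e : H.edgeSet, c e.1 < k := by
    rintro ⟨e, he⟩
    induction e using Sym2.ind with
    | _ a b => simpa using h1 a b he
  refine ⟨Coloring.mk (fun e => ⟨c e.1, hm e⟩) ?_⟩
  rintro ⟨e, he⟩ ⟨f, hf⟩ hef heq
  rw [lineGraph_adj_iff_exists] at hef
  obtain ⟨hne, a, ha, hb⟩ := hef
  simp only [Fin.mk.injEq] at heq
  simp only at ha hb
  obtain ⟨b, rfl⟩ := Sym2.mem_iff_exists.1 ha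
  obtain ⟨b', rfl⟩ := Sym2.mem_iff_exists.1 hb
  refine h2 a b b' he hf ?_ heq
  rintro rfl
  exact hne rfl

def Crit (G : SimpleGraph V) (k : ℕ) : Prop :=
  ¬ EC G (Finset.range k) ∧ ∀ G' < G, EC G' (Finset.range k)

lemma exists_crit (H : SimpleGraph V) (k : ℕ) (h : ¬ EC H (Finset.range k)) :
    ∃ G ≤ H, Crit G k := by
  obtain ⟨G, hG, hmin⟩ := WellFounded.has_min (wellFounded_lt (α := SimpleGraph V))
    {G | G ≤ H ∧ ¬ EC G (Finset.range k)} ⟨H, le_rfl, h⟩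
  refine ⟨G, hG.1, hG.2, fun G' hG' => ?_⟩
  by_contra hn
  exact hmin G' ⟨hG'.le.trans hG.1, hn⟩ hG'

variable {G : SimpleGraph V} {k : ℕ}

lemma Crit.nbrs (hG : Crit G k) (hd : ∀ u, dg G u ≤ k) {v b : V} (hb : G.Adj v b) :
    ∃ x y, x ≠ y ∧ G.Adj v x ∧ G.Adj v y ∧ dg G x = k ∧ dg G y = k := by
  by_contra hcon
  have h0 : ∃ u0, ∀ u, G.Adj v u → u ≠ u0 → dg G u < k := by
    by_cases hx : ∃ x, G.Adj v x ∧ dg G x = k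
    · obtain ⟨x, hx, hxk⟩ := hx
      refine ⟨x, fun u hu hne => lt_of_le_of_ne (hd u) fun huk => ?_⟩
      exact hcon ⟨u, x, hne, hu, hx, huk, hxk⟩
    · push Not at hx
      exact ⟨v, fun u hu _ => lt_of_le_of_ne (hd u) (hx u hu)⟩
  obtain ⟨u0, h0⟩ := h0
  apply hG.1
  apply efk k G v u0 (Finset.range k) (by simp) (hd v) (fun u _ => hd u) h0
  apply hG.2
  apply lt_of_le_of_ne
  · intro a b hab; exact hab.1
  · intro h
    rw [← h] at hb
    exact hb.2.1 rfl

lemma Crit.edge (hG : Crit G k) : ∃ a b, G.Adj a b := by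
  by_contra h
  push Not at h
  exact hG.1 ⟨fun _ => 0, fun a b hab => absurd hab (h a b), fun a b _ hab => absurd hab (h a b)⟩

lemma isEC_update {D G' : SimpleGraph V} {K : Finset ℕ} {c : Sym2 V → ℕ} {x : ℕ} {a b : V}
    (hc : IsEC D K c) (hx : x ∈ K) (ha : Miss D c a x) (hb : Miss D c b x)
    (hG' : ∀ p q, G'.Adj p q → s(p, q) ≠ s(a, b) → D.Adj p q) :
    IsEC G' K (Function.update c s(a, b) x) := by
  constructor
  · intro p q hpq
    by_cases h : s(p, q) = s(a, b)
    · rw [h]; simpa using hx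
    · rw [Function.update_of_ne h]; exact hc.1 p q (hG' p q hpq h)
  · intro p q q' hq hq' hne
    have key : ∀ r r', s(p, r) = s(a, b) → D.Adj p r' → x ≠ c s(p, r') := by
      intro r r' h hr
      rw [Sym2.eq_iff] at h
      rcases h with ⟨rfl, rfl⟩ | ⟨rfl, rfl⟩
      · exact (ha r' hr).symm
      · exact (hb r' hr).symm
    by_cases h : s(p, q) = s(a, b) <;> by_cases h' : s(p, q') = s(a, b)
    · rw [← h'] at h
      exact absurd (Sym2.congr_right.1 h) hne
    · rw [h, Function.update_self, Function.update_of_ne h']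
      exact key q q' h (hG' _ _ hq' h')
    · rw [h', Function.update_self, Function.update_of_ne h]
      exact (key q' q h' (hG' _ _ hq h)).symm
    · rw [Function.update_of_ne h, Function.update_of_ne h']
      exact hc.2 p q q' (hG' _ _ hq h) (hG' _ _ hq' h') hne

lemma notmiss_card {D : SimpleGraph V} {K : Finset ℕ} {c : Sym2 V → ℕ} (hc : IsEC D K c) (u : V) :
    (K.filter (fun x => ¬ Miss D c u x)).card = dg D u := by
  have := miss_card hc u
  have := Finset.card_filter_add_card_filter_not (s := K) (Miss D c u)
  omega

lemma Crit.lemmaA (hG : Crit G k) (hk : 3 ≤ k) (hd : ∀ u, dg G u ≤ k) {v z1 z2 : V} (hz : z1 ≠ z2)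
    (h1 : G.Adj v z1) (h2 : G.Adj v z2) (d1 : dg G z1 = 2) (d2 : dg G z2 = 2) : False := by
  set K := Finset.range k with hK
  set D := G.deleteEdges {s(v, z1)} with hD
  have hDadj : ∀ a b, D.Adj a b ↔ G.Adj a b ∧ s(a, b) ≠ s(v, z1) := by
    intro a b; simp [hD, deleteEdges_adj]
  have ext : ∀ c x, IsEC D K c → x ∈ K → Miss D c v x → Miss D c z1 x → False := by
    intro c x hc hx hm1 hm2
    apply hG.1
    exact ⟨_, isEC_update hc hx hm1 hm2 (fun p q h1 h2 => (hDadj p q).2 ⟨h1, h2⟩)⟩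
  have hDz1 : dg D z1 = 1 := by
    have := dg_eq_succ (G := G) (G' := D) z1 v (by
      intro b
      rw [hDadj]
      refine and_congr_right fun hb => not_congr ?_
      rw [Sym2.eq_swap, Sym2.congr_left]) h1.symm
    omega
  have hDv : dg D v < k := by
    have := dg_lt (G := G) (G' := D) v z1 (fun b hb => ((hDadj _ _).1 hb).1) h1 (by
      rw [hDadj]; simp)
    have := hd v
    omega
  have hDz2 : dg D z2 = 2 := by
    rw [← d2]
    unfold dg
    congr 1
    ext b
    simp only [Finset.mem_filter, Finset.mem_univ, true_and, hDadj, and_iff_left_iff_imp]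
    intro hb h
    rw [Sym2.eq_iff] at h
    rcases h with ⟨h, _⟩ | ⟨h, _⟩
    · exact h2.ne' h
    · exact hz h.symm
  have hz1m : ∀ c x y, IsEC D K c → x ∈ K → y ∈ K → x ≠ y → ¬ Miss D c z1 x → Miss D c z1 y := by
    intro c x y hc hx hy hxy hmx
    by_contra hmy
    have := notmiss_card hc z1
    rw [hDz1] at this
    have h2 := Finset.card_le_one.1 this.le x (by simp [hx, hmx]) y (by simp [hy, hmy])
    exact hxy h2
  have hvz2 : D.Adj v z2 := by
    rw [hDadj]
    refine ⟨h2, fun h => hz (Sym2.congr_right.1 h).symm⟩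
  have A2 : ∀ c x, IsEC D K c → x ∈ K → Miss D c v x → Miss D c z2 x → False := by
    intro c x hc hx hm1 hm2
    have hβ := hc.1 v z2 hvz2
    have hne : x ≠ c s(v, z2) := (hm1 z2 hvz2).symm
    have hc2 : IsEC D K (Function.update c s(v, z2) x) :=
      isEC_update hc hx hm1 hm2 (fun p q h _ => h)
    refine ext _ (c s(v, z2)) hc2 hβ ?_ ?_
    · intro b hb
      by_cases h : s(v, b) = s(v, z2)
      · rw [h]; simpa using hne
      · rw [Function.update_of_ne h]
        apply hc.2 v b z2 hb hvz2
        rintro rfl; exact h rfl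
    · have hz1 : Miss D c z1 (c s(v, z2)) := by
        apply hz1m c x _ hc hx hβ hne
        intro hm; exact ext c x hc hx hm1 hm
      intro b hb
      rw [Function.update_of_ne]
      · exact hz1 b hb
      · intro h
        rw [Sym2.eq_iff] at h
        rcases h with ⟨h, _⟩ | ⟨h, _⟩
        · exact h1.ne' h
        · exact hz h
  obtain ⟨c, hc⟩ : EC D K := by
    apply hG.2
    apply lt_of_le_of_ne
    · intro a b hab; exact ((hDadj _ _).1 hab).1
    · intro h
      rw [← h, hDadj] at h1
      exact h1.2 rfl
  obtain ⟨α, hα, hαv⟩ : ∃ α ∈ K, Miss D c v α := by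
    have h3 := miss_card hc v
    rw [hK, Finset.card_range] at h3
    obtain ⟨α, hα⟩ : (K.filter (Miss D c v)).Nonempty := Finset.card_pos.1 (by rw [hK]; omega)
    exact ⟨α, (Finset.mem_filter.1 hα).1, (Finset.mem_filter.1 hα).2⟩
  set β := c s(v, z2) with hβd
  have hβ : β ∈ K := hc.1 v z2 hvz2
  have hαβ : α ≠ β := (hαv z2 hvz2).symm
  obtain ⟨δ, hδ, hδαβ⟩ : ∃ δ ∈ K, δ ∉ ({α, β} : Finset ℕ) := by
    by_contra hcon
    push Not at hcon
    have := Finset.card_le_card (s := K) (t := {α, β}) hcon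
    have h5 := Finset.card_le_two (a := α) (b := β)
    rw [hK, Finset.card_range] at this
    omega
  simp only [Finset.mem_insert, Finset.mem_singleton, not_or] at hδαβ
  have hz2δ : Miss D c z2 δ := by
    by_contra hm
    have := notmiss_card hc z2
    rw [hDz2] at this
    have h3 : ({α, β, δ} : Finset ℕ) ⊆ K.filter (fun x => ¬ Miss D c z2 x) := by
      intro x hx
      simp only [Finset.mem_insert, Finset.mem_singleton] at hx
      rcases hx with rfl | rfl | rfl
      · exact Finset.mem_filter.2 ⟨hα, fun h => A2 c _ hc hα hαv h⟩
      · refine Finset.mem_filter.2 ⟨hβ, fun h => h v hvz2.symm ?_⟩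
        rw [Sym2.eq_swap]
      · exact Finset.mem_filter.2 ⟨hδ, hm⟩
    have h4 := Finset.card_le_card h3
    rw [Finset.card_eq_three.2 ⟨α, β, δ, hαβ, fun h => hδαβ.1 h.symm, fun h => hδαβ.2 h.symm, rfl⟩] at h4
    omega
  have hz1δ : Miss D c z1 δ :=
    hz1m c α δ hc hα hδ (fun h => hδαβ.1 h.symm) (fun h => ext c α hc hα hαv h)
  by_cases hr : (KG D c α δ).Reachable z1 v
  · have hr2 : ¬ (KG D c α δ).Reachable z1 z2 := by
      intro hr2
      exact kempe_ends hc v z1 z2 h1.ne h2.ne hz hr (Reachable.refl _) hr2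
        (Or.inl hαv) (Or.inr hz1δ) (Or.inr hz2δ)
    have hr3 : ¬ (KG D c α δ).Reachable z2 v := fun h => hr2 (hr.trans h.symm)
    refine A2 (kswap D c α δ z2) α (kswap_isEC hc hα hδ) hα ?_ ?_
    · rwa [kswap_miss_out hr3]
    · rw [kswap_miss_in (Reachable.refl _)]; simpa using hz2δ
  · refine ext (kswap D c α δ z1) α (kswap_isEC hc hα hδ) hα ?_ ?_
    · rwa [kswap_miss_out hr]
    · rw [kswap_miss_in (Reachable.refl _)]; simpa using hz1δ

/-! cuts -/

noncomputable def cutd (G : SimpleGraph V) (S : Finset V) : ℕ :=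
  (Finset.univ.filter (fun p : V × V => p.1 ∈ S ∧ p.2 ∉ S ∧ G.Adj p.1 p.2)).card

lemma cutd_compl (G : SimpleGraph V) (S : Finset V) : cutd G Sᶜ = cutd G S := by
  unfold cutd
  apply Finset.card_bij (fun p _ => (p.2, p.1))
  · intro p hp
    simp only [Finset.mem_filter, Finset.mem_univ, true_and, Finset.mem_compl, not_not] at hp ⊢
    exact ⟨hp.2.1, hp.1, hp.2.2.symm⟩
  · rintro ⟨a, b⟩ _ ⟨c, d⟩ _ h
    simp only [Prod.mk.injEq] at h ⊢
    tauto
  · rintro ⟨a, b⟩ hp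
    simp only [Finset.mem_filter, Finset.mem_univ, true_and] at hp
    refine ⟨(b, a), ?_, rfl⟩
    simp only [Finset.mem_filter, Finset.mem_univ, true_and, Finset.mem_compl, not_not]
    exact ⟨hp.2.1, hp.1, hp.2.2.symm⟩

lemma cutd_submod (G : SimpleGraph V) (S Y : Finset V) :
    cutd G (S ∪ Y) + cutd G (S ∩ Y) ≤ cutd G S + cutd G Y := by
  unfold cutd
  simp only [Finset.card_filter]
  rw [← Finset.sum_add_distrib, ← Finset.sum_add_distrib]
  apply Finset.sum_le_sum
  rintro ⟨a, b⟩ _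
  simp only [Finset.mem_union, Finset.mem_inter]
  by_cases h1 : a ∈ S <;> by_cases h2 : a ∈ Y <;> by_cases h3 : b ∈ S <;> by_cases h4 : b ∈ Y <;>
    by_cases h5 : G.Adj a b <;> simp [h1, h2, h3, h4, h5]

lemma Crit.claimC (hG : Crit G k) (hd : ∀ u, dg G u ≤ k) (S : Finset V) (s : V) (hs : s ∈ S)
    (hsk : dg G s = k) (huniq : ∀ x ∈ S, dg G x = k → x = s) : k ≤ cutd G S := by
  have ht : ∀ b, ∃ t, G.Adj s b → G.Adj b t ∧ t ≠ s ∧ dg G t = k := by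
    intro b
    by_cases hb : G.Adj s b
    · obtain ⟨x, y, hxy, hx, hy, hxk, hyk⟩ := hG.nbrs hd hb.symm
      by_cases h : x = s
      · exact ⟨y, fun _ => ⟨hy, fun h' => hxy (h.trans h'.symm), hyk⟩⟩
      · exact ⟨x, fun _ => ⟨hx, h, hxk⟩⟩
    · exact ⟨b, fun h => absurd h hb⟩
  choose t ht using ht
  rw [← hsk]
  unfold dg cutd
  apply Finset.card_le_card_of_injOn (fun b => if b ∈ S then (b, t b) else (s, b))
  · intro b hb
    simp only [Finset.coe_filter, Finset.mem_univ, true_and, Set.mem_ofPred_eq] at hb ⊢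
    split_ifs with h
    · refine ⟨h, fun h' => (ht b hb).2.1 (huniq _ h' (ht b hb).2.2), (ht b hb).1⟩
    · exact ⟨hs, h, hb⟩
  · intro b hb b' hb' h
    simp only [Finset.coe_filter, Finset.mem_univ, true_and, Set.mem_ofPred_eq] at hb hb'
    simp only at h
    split_ifs at h <;> simp only [Prod.mk.injEq] at h
    · exact h.1
    · exact absurd h.1 hb.ne'
    · exact absurd h.1.symm hb'.ne'
    · exact h.2

def IsMinCut (G : SimpleGraph V) (s t : V) (S : Finset V) : Prop :=
  s ∈ S ∧ t ∉ S ∧ ∀ S', s ∈ S' → t ∉ S' → cutd G S ≤ cutd G S'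

lemma exists_minCut (G : SimpleGraph V) (s t : V) (hst : s ≠ t) : ∃ S, IsMinCut G s t S := by
  obtain ⟨S, hS, hmin⟩ := Finset.exists_min_image
    (Finset.univ.filter (fun S : Finset V => s ∈ S ∧ t ∉ S)) (cutd G)
    ⟨{s}, by simpa using hst.symm⟩
  simp only [Finset.mem_filter, Finset.mem_univ, true_and] at hS hmin
  exact ⟨S, hS.1, hS.2, fun S' h1 h2 => hmin S' ⟨h1, h2⟩⟩

lemma Crit.cut (hG : Crit G k) (hd : ∀ u, dg G u ≤ k) :
    ∃ v y, v ≠ y ∧ dg G v = k ∧ ∀ S : Finset V, v ∈ S → y ∉ S → k ≤ cutd G S := by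
  by_contra hcon
  push Not at hcon
  have hmc : ∀ s t, s ≠ t → dg G s = k → ∃ S, IsMinCut G s t S ∧ cutd G S < k := by
    intro s t hst hs
    obtain ⟨S, hS⟩ := exists_minCut G s t hst
    obtain ⟨S', h1, h2, h3⟩ := hcon s t hst hs
    exact ⟨S, hS, lt_of_le_of_lt (hS.2.2 S' h1 h2) h3⟩
  have hex : ∃ m s t S, dg G s = k ∧ IsMinCut G s t S ∧ cutd G S < k ∧
      (S.filter (fun x => dg G x = k)).card = m := by
    obtain ⟨a, b, hab⟩ := hG.edge
    obtain ⟨x, y, hxy, _, _, hx, hy⟩ := hG.nbrs hd hab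
    obtain ⟨S, hS, hSk⟩ := hmc x y hxy hx
    exact ⟨_, x, y, S, hx, hS, hSk, rfl⟩
  obtain ⟨s, t, S, hs, hS, hSk, hm⟩ := Nat.find_spec hex
  have hmin : ∀ s' t' S', dg G s' = k → IsMinCut G s' t' S' → cutd G S' < k →
      (S.filter (fun x => dg G x = k)).card ≤ (S'.filter (fun x => dg G x = k)).card := by
    intro s' t' S' h1 h2 h3
    rw [hm]
    exact Nat.find_min' hex ⟨s', t', S', h1, h2, h3, rfl⟩
  by_cases huniq : ∀ x ∈ S, dg G x = k → x = s
  · have := hG.claimC hd S s hS.1 hs huniq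
    omega
  push Not at huniq
  obtain ⟨y, hyS, hyk, hys⟩ := huniq
  obtain ⟨Y0, hY0, hY0k⟩ := hmc s y hys.symm hs
  have smaller : ∀ Y z, z ∈ S → dg G z = k → z ∉ Y →
      ((S ∩ Y).filter (fun x => dg G x = k)).card < (S.filter (fun x => dg G x = k)).card := by
    intro Y z hz hzk hzY
    apply Finset.card_lt_card
    rw [Finset.ssubset_iff_of_subset]
    · exact ⟨z, by simp [hz, hzk], by simp [hzY]⟩
    · intro x; simp only [Finset.mem_filter, Finset.mem_inter]; tauto
  by_cases ht : t ∈ Y0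
  · have e1 := cutd_submod G S Y0ᶜ
    have e2 := hS.2.2 (S ∪ Y0ᶜ) (by simp [hS.1]) (by simp [hS.2.1, ht])
    rw [cutd_compl] at e1
    have e3 := smaller Y0ᶜ s hS.1 hs (by simp [hY0.1])
    have e4 := hmin y s (S ∩ Y0ᶜ) hyk ⟨by simp [hyS, hY0.2.1], by simp [hY0.1], ?_⟩ (by omega)
    · omega
    · intro S' h1 h2
      have := hY0.2.2 S'ᶜ (by simpa using h2) (by simpa using h1)
      rw [cutd_compl] at this
      omega
  · have e1 := cutd_submod G S Y0
    have e2 := hS.2.2 (S ∪ Y0) (by simp [hS.1]) (by simp [hS.2.1, ht])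
    have e3 := smaller Y0 y hyS hyk hY0.2.1
    have e4 := hmin s y (S ∩ Y0) hs ⟨by simp [hS.1, hY0.1], by simp [hY0.2.1], ?_⟩ (by omega)
    · omega
    · intro S' h1 h2
      have := hY0.2.2 S' h1 h2
      omega

end TOI
end Crit

open SimpleGraph

section Menger
open Classical
set_option linter.unusedSectionVars false
set_option linter.unusedVariables false

namespace TOI

variable {V : Type*} [Fintype V] {G : SimpleGraph V}

noncomputable def ind : {u w : V} → G.Walk u w → V → V → ℤ
  | _, _, .nil, _, _ => 0
  | _, _, .cons (u := u) (v := x) _ p, a, b =>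
      (if a = u ∧ b = x then 1 else 0) - (if a = x ∧ b = u then 1 else 0) + ind p a b

def HD {u w : V} (p : G.Walk u w) (a b : V) : Prop := (a, b) ∈ p.darts.map Dart.toProd

lemma HD_cons {u x w : V} (h : G.Adj u x) (p : G.Walk x w) (a b : V) :
    HD (Walk.cons h p) a b ↔ (a = u ∧ b = x) ∨ HD p a b := by
  simp [HD]

lemma HD_supp {u w : V} (p : G.Walk u w) {a b : V} (h : HD p a b) : a ∈ p.support ∧ b ∈ p.support := by
  simp only [HD, List.mem_map] at h
  obtain ⟨d, hd, he⟩ := h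
  have h1 := p.dart_fst_mem_support_of_mem_darts hd
  have h2 := p.dart_snd_mem_support_of_mem_darts hd
  rw [he] at h1 h2
  exact ⟨h1, h2⟩

lemma HD_adj {u w : V} (p : G.Walk u w) {a b : V} (h : HD p a b) : G.Adj a b := by
  simp only [HD, List.mem_map] at h
  obtain ⟨d, hd, he⟩ := h
  have := d.adj
  rwa [he] at this

lemma HD_edges {u w : V} (p : G.Walk u w) {a b : V} : s(a, b) ∈ p.edges ↔ HD p a b ∨ HD p b a := by
  induction p with
  | nil => simp [HD]
  | cons h p ih =>
    rw [HD_cons, HD_cons, Walk.edges_cons, List.mem_cons, ih, Sym2.eq_iff]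
    tauto

lemma ind_anti {u w : V} (p : G.Walk u w) (a b : V) : ind p b a = - ind p a b := by
  induction p with
  | nil => simp [ind]
  | cons h p ih =>
    simp only [ind, ih]
    have e1 : ∀ x y : V, (b = x ∧ a = y) ↔ (a = y ∧ b = x) := by intros; tauto
    simp only [e1]; ring

lemma ind_pos {u w : V} (p : G.Walk u w) (a b : V) (h : 0 < ind p a b) : HD p a b := by
  induction p with
  | nil => simp [ind] at h
  | @cons u x w h' p ih =>
    rw [HD_cons]
    simp only [ind] at h
    by_cases h1 : a = u ∧ b = x
    · exact Or.inl h1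
    · right
      rw [if_neg h1] at h
      apply ih
      split_ifs at h <;> omega

lemma ind_ne {u w : V} (p : G.Walk u w) (a b : V) (h : ind p a b ≠ 0) : HD p a b ∨ HD p b a := by
  rcases lt_or_gt_of_ne h with h | h
  · right; apply ind_pos; rw [ind_anti]; omega
  · left; exact ind_pos p a b h

lemma ind_dart {u w : V} (p : G.Walk u w) (hp : p.IsPath) (a b : V) (h : HD p a b) :
    ind p a b = 1 := by
  induction p with
  | nil => simp [HD] at h
  | @cons u x w h' p ih =>
    rw [Walk.cons_isPath_iff] at hp
    rw [HD_cons] at h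
    simp only [ind]
    rcases h with ⟨rfl, rfl⟩ | h
    · have : ind p a b = 0 := by
        by_contra hne
        rcases ind_ne p a b hne with h | h
        · exact hp.2 (HD_supp p h).1
        · exact hp.2 (HD_supp p h).2
      rw [this, if_pos ⟨rfl, rfl⟩, if_neg (fun h => h'.ne h.1)]
      norm_num
    · have ha : a ≠ u := by rintro rfl; exact hp.2 (HD_supp p h).1
      have hb : b ≠ u := by rintro rfl; exact hp.2 (HD_supp p h).2
      rw [ih hp.1 h, if_neg (fun h => ha h.1), if_neg (fun h => hb h.2)]
      norm_num

lemma ind_le {u w : V} (p : G.Walk u w) (hp : p.IsPath) (a b : V) : ind p a b ≤ 1 := by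
  by_contra h
  push Not at h
  have := ind_dart p hp a b (ind_pos p a b (by omega))
  omega

lemma ind_sum {u w : V} (p : G.Walk u w) (a : V) :
    ∑ b, ind p a b = (if a = u then 1 else 0) - (if a = w then 1 else 0) := by
  induction p with
  | nil => simp [ind]
  | @cons u x w h' p ih =>
    simp only [ind, Finset.sum_add_distrib, Finset.sum_sub_distrib, ih]
    have e : ∀ y z : V, ∑ b, (if a = y ∧ b = z then (1 : ℤ) else 0) = if a = y then 1 else 0 := by
      intro y z
      by_cases h : a = y <;> simp [h]
    rw [e, e]; ring

structure IsFlow (G : SimpleGraph V) (v y : V) (m : ℤ) (φ : V → V → ℤ) : Prop where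
  anti : ∀ a b, φ b a = - φ a b
  bd : ∀ a b, φ a b ≤ 1
  sup : ∀ a b, ¬ G.Adj a b → φ a b = 0
  cons : ∀ a, ∑ b, φ a b = (if a = v then m else 0) - (if a = y then m else 0)

lemma IsFlow.cut {v y : V} {m : ℤ} {φ : V → V → ℤ} (h : IsFlow G v y m φ) (R : Finset V)
    (hv : v ∈ R) (hy : y ∉ R) : ∑ a ∈ R, ∑ b ∈ Rᶜ, φ a b = m := by
  have h1 : ∑ a ∈ R, ∑ b, φ a b = m := by
    simp_rw [h.cons]
    rw [Finset.sum_sub_distrib]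
    simp [hv, hy]
  have h2 : ∑ a ∈ R, ∑ b ∈ R, φ a b = 0 := by
    have : ∑ a ∈ R, ∑ b ∈ R, φ a b = - ∑ a ∈ R, ∑ b ∈ R, φ a b := by
      conv_lhs => rw [Finset.sum_comm]
      simp_rw [← Finset.sum_neg_distrib]
      apply Finset.sum_congr rfl
      intro x _
      apply Finset.sum_congr rfl
      intro z _
      rw [h.anti z x]; ring
    omega
  simp_rw [← Finset.sum_add_sum_compl R, Finset.sum_add_distrib] at h1
  omega

lemma HD_append_adj {v x b : V} (p : G.Walk v x) (h : G.Adj x b) (c d : V) :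
    HD (p.concat h) c d → HD p c d ∨ (c = x ∧ d = b) := by
  simp only [HD, Walk.darts_concat, List.concat_eq_append, List.map_append, List.mem_append]
  simp

lemma reach_or_cut (G : SimpleGraph V) (v y : V) (Q : V → V → Prop) :
    (∃ p : G.Walk v y, p.IsPath ∧ ∀ a b, HD p a b → Q a b) ∨
    ∃ R : Finset V, v ∈ R ∧ y ∉ R ∧ ∀ a ∈ R, ∀ b ∉ R, G.Adj a b → ¬ Q a b := by
  by_cases h : ∃ p : G.Walk v y, ∀ a b, HD p a b → Q a b
  · left
    obtain ⟨p, hp⟩ := h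
    refine ⟨p.bypass, p.bypass_isPath, fun a b hab => hp a b ?_⟩
    exact List.map_subset _ p.darts_bypass_subset_darts hab
  · right
    refine ⟨Finset.univ.filter (fun x => ∃ p : G.Walk v x, ∀ a b, HD p a b → Q a b), ?_, ?_, ?_⟩
    · simp only [Finset.mem_filter, Finset.mem_univ, true_and]
      exact ⟨Walk.nil, by simp [HD]⟩
    · simpa only [Finset.mem_filter, Finset.mem_univ, true_and] using h
    · intro a ha b hb hab hQ
      simp only [Finset.mem_filter, Finset.mem_univ, true_and] at ha hb
      obtain ⟨p, hp⟩ := ha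
      apply hb
      refine ⟨p.concat hab, fun c d hcd => ?_⟩
      rcases HD_append_adj p hab c d hcd with h | ⟨rfl, rfl⟩
      · exact hp c d h
      · exact hQ

lemma exists_flow {v y : V} (hvy : v ≠ y) (k : ℕ)
    (hcut : ∀ S : Finset V, v ∈ S → y ∉ S → k ≤ cutd G S) (m : ℕ) (hm : m ≤ k) :
    ∃ φ, IsFlow G v y m φ := by
  induction m with
  | zero => exact ⟨fun _ _ => 0, by simp, by simp, by simp, by simp⟩
  | succ m ih =>
    obtain ⟨φ, hφ⟩ := ih (by omega)
    rcases reach_or_cut G v y (fun a b => φ a b ≤ 0) with ⟨p, hp, hQ⟩ | ⟨R, hv, hy, hR⟩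
    · refine ⟨fun a b => φ a b + ind p a b, ?_, ?_, ?_, ?_⟩
      · intro a b; have e1 := hφ.anti a b; have e2 := ind_anti p a b; linarith
      · intro a b
        have h1 := ind_le p hp a b
        have h2 := hφ.bd a b
        by_cases h : 0 < ind p a b
        · have := hQ a b (ind_pos p a b h)
          omega
        · omega
      · intro a b hab
        rw [hφ.sup a b hab, zero_add]
        by_contra hne
        rcases ind_ne p a b hne with h | h
        · exact hab (HD_adj p h)
        · exact hab (HD_adj p h).symm
      · intro a
        rw [Finset.sum_add_distrib, hφ.cons, ind_sum]
        push_cast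
        split_ifs <;> ring
    · exfalso
      have h1 := hφ.cut R hv hy
      have h2 := hcut R hv hy
      have h3 : ((cutd G R : ℕ) : ℤ) ≤ ∑ a ∈ R, ∑ b ∈ Rᶜ, φ a b := by
        have : cutd G R = ∑ a ∈ R, ∑ b ∈ Rᶜ, if G.Adj a b then 1 else 0 := by
          unfold cutd
          rw [← Finset.sum_product', ← Finset.card_filter]
          congr 1
          ext ⟨a, b⟩
          simp [and_assoc]
        rw [this]
        push_cast
        apply Finset.sum_le_sum
        intro a ha
        apply Finset.sum_le_sum
        intro b hb
        split_ifs with hab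
        · have := hR a ha b (Finset.mem_compl.1 hb) hab
          omega
        · rw [hφ.sup a b hab]
      omega

lemma flow_decomp {v y : V} (hvy : v ≠ y) (m : ℕ) : ∀ φ, IsFlow G v y m φ →
    ∃ P : Fin m → G.Walk v y, (∀ i, (P i).IsPath) ∧ (∀ i a b, HD (P i) a b → φ a b = 1) ∧
      ∀ i j, i ≠ j → List.Disjoint (P i).edges (P j).edges := by
  induction m with
  | zero => intro φ _; exact ⟨fun i => i.elim0, fun i => i.elim0, fun i => i.elim0, fun i => i.elim0⟩
  | succ m ih =>
    intro φ hφ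
    rcases reach_or_cut G v y (fun a b => φ a b = 1) with ⟨p, hp, hQ⟩ | ⟨R, hv, hy, hR⟩
    · have hflow : IsFlow G v y m (fun a b => φ a b - ind p a b) := by
        refine ⟨?_, ?_, ?_, ?_⟩
        · intro a b; have e1 := hφ.anti a b; have e2 := ind_anti p a b; linarith
        · intro a b
          have h1 := ind_le p hp b a
          rw [ind_anti] at h1
          have h2 := hφ.bd a b
          by_cases h : ind p a b < 0
          · have := hQ b a (ind_pos p b a (by rw [ind_anti]; omega))
            rw [hφ.anti] at this
            omega
          · omega
        · intro a b hab
          rw [hφ.sup a b hab, zero_sub, neg_eq_zero]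
          by_contra hne
          rcases ind_ne p a b hne with h | h
          · exact hab (HD_adj p h)
          · exact hab (HD_adj p h).symm
        · intro a
          rw [Finset.sum_sub_distrib, hφ.cons, ind_sum]
          push_cast
          split_ifs <;> ring
      obtain ⟨P, hP, hP1, hP2⟩ := ih _ hflow
      have hdis : ∀ i, List.Disjoint p.edges (P i).edges := by
        intro i e he he'
        induction e using Sym2.ind with
        | _ a b =>
          rw [HD_edges] at he he'
          have z : ∀ a b, HD p a b → φ a b - ind p a b = 0 := by
            intro a b h
            rw [hQ a b h, ind_dart p hp a b h]; norm_num
          have z1 : φ a b - ind p a b = 0 := by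
            rcases he with h | h
            · exact z a b h
            · have := z b a h
              rw [hφ.anti, ind_anti] at this
              omega
          have z2 : φ b a - ind p b a = 0 := by
            rw [hφ.anti, ind_anti]; omega
          rcases he' with h | h
          · have := hP1 i a b h; omega
          · have := hP1 i b a h; omega
      refine ⟨Fin.cons p P, ?_, ?_, ?_⟩
      · intro i
        refine Fin.cases ?_ (fun i => ?_) i
        · exact hp
        · exact hP i
      · intro i
        refine Fin.cases ?_ (fun i => ?_) i
        · exact hQ
        · intro a b h
          have h1 := hP1 i a b h
          by_cases hz : ind p a b = 0
          · omega
          · rcases ind_ne p a b hz with h | h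
            · exact hQ a b h
            · exfalso
              have e1 := hQ b a h
              have e2 := ind_dart p hp b a h
              rw [hφ.anti] at e1
              rw [ind_anti] at e2
              omega
      · intro i j
        refine Fin.cases ?_ (fun i => ?_) i <;> refine Fin.cases ?_ (fun j => ?_) j
        · intro h; exact absurd rfl h
        · intro _; exact hdis j
        · intro _; exact (hdis i).symm
        · intro h; exact hP2 i j (fun h' => h (by rw [h']))
    · exfalso
      have h1 := hφ.cut R hv hy
      have h3 : ∑ a ∈ R, ∑ b ∈ Rᶜ, φ a b ≤ 0 := by
        apply Finset.sum_nonpos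
        intro a ha
        apply Finset.sum_nonpos
        intro b hb
        by_cases hab : G.Adj a b
        · have e1 := hR a ha b (Finset.mem_compl.1 hb) hab
          have e2 := hφ.bd a b
          omega
        · rw [hφ.sup a b hab]
      push_cast at h1
      omega

theorem menger {v y : V} (hvy : v ≠ y) (k : ℕ)
    (hcut : ∀ S : Finset V, v ∈ S → y ∉ S → k ≤ cutd G S) :
    ∃ P : Fin k → G.Walk v y, (∀ i, (P i).IsPath) ∧
      ∀ i j, i ≠ j → List.Disjoint (P i).edges (P j).edges := by
  obtain ⟨φ, hφ⟩ := exists_flow hvy k hcut k le_rfl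
  obtain ⟨P, h1, _, h2⟩ := flow_decomp hvy k φ hφ
  exact ⟨P, h1, h2⟩

end TOI
end Menger

open SimpleGraph

section Asm
open Classical
set_option linter.unusedSectionVars false
set_option linter.unusedVariables false

namespace TOI

lemma edge_walk {W : Type*} (L : SimpleGraph W) {a b : W} (h : L.Adj a b) :
    ∃ w : L.Walk a b, w.IsPath ∧ Odd w.length ∧ w.edges = [s(a, b)] ∧ w.support = [a, b] := by
  refine ⟨Walk.cons h Walk.nil, ?_, ?_, ?_, ?_⟩
  · simp [h.ne]
  · simp
  · simp
  · simp

lemma build {W : Type*} (L : SimpleGraph W) (k : ℕ) (f : W) (e : Fin k → W)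
    (he : Function.Injective e) (hf : ∀ i, e i ≠ f) (hadj : ∀ i j, i ≠ j → L.Adj (e i) (e j))
    (Q : ∀ i, L.Walk f (e i)) (hQ : ∀ i, (Q i).IsPath) (hodd : ∀ i, Odd (Q i).length)
    (hterm : ∀ i j, e j ∈ (Q i).support → j = i)
    (hdis : ∀ i j, i ≠ j → List.Disjoint (Q i).edges (Q j).edges) :
    TotallyOddStrongCliqueImmersion L (k + 1) := by
  let φ : Fin (k + 1) → W := Fin.cons f e
  have hφ : Function.Injective φ := by
    rw [Fin.cons_injective_iff]
    refine ⟨?_, he⟩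
    rintro ⟨i, hi⟩
    exact hf i hi
  have key : ∀ i j : Fin (k + 1), ∃ w : L.Walk (φ i) (φ j),
      (i < j → w.IsPath ∧ Odd w.length ∧ ∀ l, φ l ∈ w.support → l = i ∨ l = j) ∧
      (∀ a b, i = Fin.succ a → j = Fin.succ b → i < j → w.edges = [s(e a, e b)]) ∧
      (∀ b, i = 0 → j = Fin.succ b → w.edges = (Q b).edges) := by
    intro i j
    refine Fin.cases ?_ (fun a => ?_) i <;> refine Fin.cases ?_ (fun b => ?_) j
    · refine ⟨Walk.nil, fun h => absurd h (lt_irrefl _), fun a b h => absurd h (Fin.succ_ne_zero a).symm,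
        fun b _ h => absurd h (Fin.succ_ne_zero b).symm⟩
    · refine ⟨(Q b), fun _ => ⟨hQ b, hodd b, ?_⟩, fun a b h => absurd h (Fin.succ_ne_zero a).symm, ?_⟩
      · intro l
        refine Fin.cases ?_ (fun l => ?_) l
        · intro _; exact Or.inl rfl
        · intro h; right; rw [hterm b l h]
      · intro b' _ h
        have h := Fin.succ_inj.1 h
        subst h
        rfl
    · refine ⟨(Q a).reverse, fun h => absurd h (Fin.not_lt_zero _), fun a b _ h => absurd h (Fin.succ_ne_zero b).symm,
        fun b _ h => absurd h (Fin.succ_ne_zero b).symm⟩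
    · by_cases hab : a = b
      · subst hab
        exact ⟨Walk.nil, fun h => absurd h (lt_irrefl _), fun a b _ _ h => absurd h (lt_irrefl _),
          fun b h => absurd h (Fin.succ_ne_zero _)⟩
      · have hw : ∃ w : L.Walk (φ a.succ) (φ b.succ), w.IsPath ∧ Odd w.length ∧
            w.edges = [s(e a, e b)] ∧ w.support = [φ a.succ, φ b.succ] := edge_walk L (hadj a b hab)
        obtain ⟨w, w1, w2, w3, w4⟩ := hw
        refine ⟨w, fun _ => ⟨w1, w2, ?_⟩, ?_, fun b h => absurd h (Fin.succ_ne_zero _)⟩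
        · intro l hl
          rw [w4] at hl
          simp only [List.mem_cons, List.not_mem_nil, or_false] at hl
          rcases hl with h | h
          · left; exact hφ h
          · right; exact hφ h
        · intro a' b' h1 h2 _
          rw [← Fin.succ_inj.1 h1, ← Fin.succ_inj.1 h2, w3]
  choose P hP1 hP2 hP3 using key
  refine ⟨⟨φ, hφ⟩, P, fun i j h => (hP1 i j h).1, fun i j h => (hP1 i j h).2.1,
    fun i j l h => (hP1 i j h).2.2 l, ?_⟩
  have hmix : ∀ a b c, a ≠ b → s(e a, e b) ∉ (Q c).edges := by
    intro a b c hab h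
    have h1 := hterm c a (Walk.fst_mem_support_of_mem_edges _ h)
    have h2 := hterm c b (Walk.snd_mem_support_of_mem_edges _ h)
    exact hab (h1.trans h2.symm)
  intro i j i' j' hij hij'
  have hj : ∃ b, j = Fin.succ b := Fin.exists_succ_eq.2 (by rintro rfl; exact Fin.not_lt_zero _ hij) |>.imp fun _ h => h.symm
  have hj' : ∃ b, j' = Fin.succ b := Fin.exists_succ_eq.2 (by rintro rfl; exact Fin.not_lt_zero _ hij') |>.imp fun _ h => h.symm
  obtain ⟨b, hb⟩ := hj
  obtain ⟨b', hb'⟩ := hj'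
  have hi : i = 0 ∨ ∃ a, i = Fin.succ a := Fin.eq_zero_or_eq_succ i
  have hi' : i' = 0 ∨ ∃ a, i' = Fin.succ a := Fin.eq_zero_or_eq_succ i'
  intro hne
  rcases hi with h0 | ⟨a, ha⟩ <;> rcases hi' with h0' | ⟨a', ha'⟩
  · rw [hP3 i j b h0 hb, hP3 i' j' b' h0' hb']
    apply hdis
    rintro rfl
    exact hne (by rw [h0, h0', hb, hb'])
  · rw [hP3 i j b h0 hb, hP2 i' j' a' b' ha' hb' hij']
    have : a' ≠ b' := by rintro rfl; rw [ha', hb'] at hij'; exact lt_irrefl _ hij'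
    simpa using hmix a' b' b this
  · rw [hP2 i j a b ha hb hij, hP3 i' j' b' h0' hb']
    have : a ≠ b := by rintro rfl; rw [ha, hb] at hij; exact lt_irrefl _ hij
    simpa using hmix a b b' this
  · rw [hP2 i j a b ha hb hij, hP2 i' j' a' b' ha' hb' hij']
    simp only [List.disjoint_singleton, List.mem_singleton]
    intro h
    rw [Sym2.eq_iff] at h
    subst ha hb ha' hb'
    rw [Fin.succ_lt_succ_iff] at hij hij'
    rcases h with ⟨h1, h2⟩ | ⟨h1, h2⟩
    · have h1 := he h1
      have h2 := he h2
      subst h1 h2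
      exact hne rfl
    · have h1 := he h1
      have h2 := he h2
      subst h1 h2
      exact lt_asymm hij hij'

lemma star_case {V : Type*} (H : SimpleGraph V) (v : V) (t : ℕ) (z : Fin t → V)
    (hz : Function.Injective z) (hadj : ∀ i, H.Adj v (z i)) :
    TotallyOddStrongCliqueImmersion H.lineGraph t := by
  cases t with
  | zero => exact ⟨⟨fun i => i.elim0, fun i => i.elim0⟩, fun i => i.elim0, fun i => i.elim0,
      fun i => i.elim0, fun i => i.elim0, fun i => i.elim0⟩
  | succ k =>
    let e : Fin (k + 1) → H.edgeSet := fun i => ⟨s(v, z i), hadj i⟩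
    have he : Function.Injective e := by
      intro i j h
      have h := Subtype.ext_iff.1 h
      exact hz (Sym2.congr_right.1 h)
    have ha : ∀ i j, i ≠ j → H.lineGraph.Adj (e i) (e j) := by
      intro i j hij
      rw [lineGraph_adj_iff_exists]
      exact ⟨he.ne hij, v, by simp [e], by simp [e]⟩
    have hw := fun i : Fin k => edge_walk H.lineGraph (ha 0 i.succ (Fin.succ_ne_zero i).symm)
    choose Q h1 h2 h3 h4 using hw
    refine build H.lineGraph k (e 0) (fun i => e i.succ) (fun i j h => Fin.succ_inj.1 (he h))
      (fun i => he.ne (Fin.succ_ne_zero i)) (fun i j h => ha _ _ (by simpa using h)) Q h1 h2 ?_ ?_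
    · intro i j h
      rw [h4] at h
      simp only [List.mem_cons, List.not_mem_nil, or_false] at h
      rcases h with h | h
      · exact absurd (he h) (Fin.succ_ne_zero j)
      · exact Fin.succ_inj.1 (he h)
    · intro i j hij
      rw [h3, h3]
      simp only [List.disjoint_singleton, List.mem_singleton]
      intro h
      have := he (Sym2.congr_right.1 h)
      exact hij (Fin.succ_inj.1 this).symm

lemma not_path_split {W : Type*} {L : SimpleGraph W} {u w : W} (q : L.Walk u w) (h : ¬ q.IsPath) :
    ∃ (x : W) (q1 : L.Walk u x) (l : L.Walk x x) (q2 : L.Walk x w), 0 < l.length ∧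
      q.length = q1.length + l.length + q2.length := by
  induction q with
  | nil => simp at h
  | @cons u b w h' q ih =>
    by_cases hq : q.IsPath
    · have hu : u ∈ q.support := by
        by_contra hu
        exact h (Walk.cons_isPath_iff _ _ |>.2 ⟨hq, hu⟩)
      refine ⟨u, Walk.nil, Walk.cons h' (q.takeUntil u hu), q.dropUntil u hu, by simp, ?_⟩
      have := congrArg Walk.length (q.take_spec hu)
      rw [Walk.length_append] at this
      simp only [Walk.length_cons, Walk.length_nil]
      omega
    · obtain ⟨x, q1, l, q2, h1, h2⟩ := ih hq
      refine ⟨x, Walk.cons h' q1, l, q2, h1, ?_⟩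
      simp only [Walk.length_cons]
      omega

lemma three_case {W : Type*} (L : SimpleGraph W) (h : ¬ L.Colorable 2) :
    TotallyOddStrongCliqueImmersion L 3 := by
  rw [two_colorable_iff_forall_loop_even] at h
  push Not at h
  have hex : ∃ n, ∃ (a : W) (p : L.Walk a a), p.length = n ∧ Odd n := by
    obtain ⟨a, p, hp⟩ := h
    exact ⟨_, a, p, rfl, by simpa using hp⟩
  obtain ⟨a, p, hpn, hodd⟩ := Nat.find_spec hex
  have hmin : ∀ (b : W) (q : L.Walk b b), Odd q.length → p.length ≤ q.length := by
    intro b q hq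
    rw [hpn]
    exact Nat.find_min' hex ⟨b, q, rfl, hq⟩
  rw [← hpn] at hodd
  clear hpn
  cases p with
  | nil => simp at hodd
  | @cons _ b _ h1 q =>
    have hq : q.IsPath := by
      by_contra hq
      obtain ⟨x, q1, l, q2, e1, e2⟩ := not_path_split q hq
      simp only [Walk.length_cons] at hmin hodd
      by_cases hl : Odd l.length
      · have := hmin x l hl
        omega
      · have := hmin a (Walk.cons h1 (q1.append q2)) (by
          simp only [Walk.length_cons, Walk.length_append]
          rw [Nat.not_odd_iff_even] at hl
          obtain ⟨r, hr⟩ := hl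
          obtain ⟨s, hs⟩ := hodd
          exact ⟨s - r, by omega⟩)
        simp only [Walk.length_cons, Walk.length_append] at this
        omega
    cases q with
    | nil => exact absurd rfl h1.ne
    | @cons _ c _ h2 p =>
      rw [Walk.cons_isPath_iff] at hq
      have hpo : Odd p.length := by
        simp only [Walk.length_cons] at hodd
        obtain ⟨s, hs⟩ := hodd
        exact ⟨s - 1, by omega⟩
      have hca : c ≠ a := by
        rintro rfl
        have := hq.1
        rw [Walk.isPath_iff_nil, ← Walk.length_eq_zero_iff] at this
        rw [this] at hpo
        simp at hpo
      obtain ⟨w, w1, w2, w3, w4⟩ := edge_walk L h1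
      obtain ⟨pr, pr1, pr2, pr3⟩ : ∃ pr : L.Walk a c, pr.IsPath ∧ Odd pr.length ∧ b ∉ pr.support :=
        ⟨p.reverse, hq.1.reverse, by simpa using hpo, by simpa using hq.2⟩
      let e : Fin 2 → W := ![b, c]
      have key : ∀ i : Fin 2, ∃ Q : L.Walk a (e i), Q.IsPath ∧ Odd Q.length ∧
          (i = 0 → Q.support = [a, b] ∧ Q.edges = [s(a, b)]) ∧
          (i = 1 → b ∉ Q.support) := by
        intro i
        fin_cases i
        · exact ⟨w, w1, w2, fun _ => ⟨w4, w3⟩, fun h => by simp at h⟩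
        · exact ⟨pr, pr1, pr2, fun h => by simp at h, fun _ => pr3⟩
      choose Q k1 k2 k3 k4 using key
      have hb1 : s(a, b) ∉ (Q 1).edges := fun h =>
        k4 1 rfl (Walk.snd_mem_support_of_mem_edges _ h)
      refine build L 2 a e ?_ ?_ ?_ Q k1 k2 ?_ ?_
      · intro i j
        fin_cases i <;> fin_cases j <;> simp [e, h2.ne, h2.ne']
      · intro i
        fin_cases i <;> simp [e, h1.ne', hca]
      · intro i j
        fin_cases i <;> fin_cases j <;> simp [e, h2, h2.symm]
      · intro i j
        fin_cases i <;> fin_cases j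
        · simp
        · intro h
          have h' := (k3 0 rfl).1
          simp only [Fin.zero_eta, Fin.isValue] at h
          rw [h'] at h
          simp [e, hca, h2.ne'] at h
        · intro h
          exact absurd h (k4 1 rfl)
        · simp
      · intro i j
        fin_cases i <;> fin_cases j
        · simp
        · intro _
          have h' := (k3 0 rfl).2
          simp only [Fin.zero_eta, Fin.isValue, Fin.mk_one]
          rw [h']
          simpa using hb1
        · intro _
          have h' := (k3 0 rfl).2
          simp only [Fin.zero_eta, Fin.isValue, Fin.mk_one]
          rw [h']
          simpa using hb1
        · simp

end TOI
end Asm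

open SimpleGraph

section Lists
open Classical
set_option linter.unusedSectionVars false
set_option linter.unusedVariables false

namespace TOI

variable {V : Type*}

def Cons2 {α : Type*} : List α → α → α → Prop
  | a :: b :: l, x, y => (x = a ∧ y = b) ∨ Cons2 (b :: l) x y
  | _, _, _ => False

lemma Cons2_mem {α : Type*} : ∀ (l : List α) (x y : α), Cons2 l x y → x ∈ l ∧ y ∈ l
  | [], _, _, h => by simp [Cons2] at h
  | [_], _, _, h => by simp [Cons2] at h
  | a :: b :: l, x, y, h => by
    rw [Cons2] at h
    rcases h with ⟨rfl, rfl⟩ | h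
    · simp
    · have := Cons2_mem (b :: l) x y h
      exact ⟨List.mem_cons_of_mem _ this.1, List.mem_cons_of_mem _ this.2⟩

lemma Cons2_append {α : Type*} (f : α) : ∀ (l : List α) (x y : α), Cons2 (l ++ [f]) x y →
    Cons2 l x y ∨ (l.getLast? = some x ∧ y = f)
  | [], _, _, h => by simp [Cons2] at h
  | [a], x, y, h => by
    simp [Cons2] at h
    right; simp [h.1, h.2]
  | a :: b :: l, x, y, h => by
    simp only [List.cons_append] at h
    rw [Cons2] at h
    rcases h with h | h
    · left; rw [Cons2]; exact Or.inl h
    · rcases Cons2_append f (b :: l) x y h with h | h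
      · left; rw [Cons2]; exact Or.inr h
      · right; rw [List.getLast?_cons_cons]; exact h

/-- adjacency of edges in the line graph -/
def RR (e f : Sym2 V) : Prop := e ≠ f ∧ ∃ x, x ∈ e ∧ x ∈ f

lemma lwalk (H : SimpleGraph V) (l : List (Sym2 V)) : ∀ (a : Sym2 V) (ha : a ∈ H.edgeSet)
    (b : Sym2 V) (hb : b ∈ H.edgeSet), (∀ x ∈ l, x ∈ H.edgeSet) → List.IsChain RR (a :: l) →
    (a :: l).getLast? = some b →
    ∃ Q : H.lineGraph.Walk ⟨a, ha⟩ ⟨b, hb⟩, Q.support.map Subtype.val = a :: l ∧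
      ∀ x y, s(x, y) ∈ Q.edges → Cons2 (a :: l) x.1 y.1 ∨ Cons2 (a :: l) y.1 x.1 := by
  induction l with
  | nil =>
    intro a ha b hb _ _ h
    simp at h
    subst h
    exact ⟨Walk.nil, by simp, by simp⟩
  | cons d l ih =>
    intro a ha b hb hm hc hl
    rw [List.getLast?_cons_cons] at hl
    rw [List.isChain_cons_cons] at hc
    have hd : d ∈ H.edgeSet := hm d (by simp)
    obtain ⟨Q, h1, h2⟩ := ih d hd b hb (fun x hx => hm x (List.mem_cons_of_mem _ hx)) hc.2 hl
    have hadj : H.lineGraph.Adj ⟨a, ha⟩ ⟨d, hd⟩ := by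
      rw [lineGraph_adj_iff_exists]
      refine ⟨fun h => hc.1.1 (Subtype.ext_iff.1 h), hc.1.2⟩
    refine ⟨Walk.cons hadj Q, by simp [h1], ?_⟩
    intro x y hxy
    rw [Walk.edges_cons, List.mem_cons] at hxy
    simp only [Cons2]
    rcases hxy with h | h
    · rw [Sym2.eq_iff] at h
      rcases h with ⟨rfl, rfl⟩ | ⟨rfl, rfl⟩
      · exact Or.inl (Or.inl ⟨rfl, rfl⟩)
      · exact Or.inr (Or.inl ⟨rfl, rfl⟩)
    · rcases h2 x y h with h | h
      · exact Or.inl (Or.inr h)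
      · exact Or.inr (Or.inr h)

/-- possible transitions -/
def Tr (E : List (Sym2 V)) (star B : Prop) (e f g ph d2 x y : Sym2 V) : Prop :=
  (x ∈ E ∧ y ∈ E) ∨ (¬ star ∧ x = g ∧ y = f) ∨ (B ∧ x = e ∧ y = ph) ∨ (B ∧ x = ph ∧ y = d2)

lemma one_list (H : SimpleGraph V) (E : List (Sym2 V)) (e f g ph d2 : Sym2 V)
    (hE : E.IsChain RR) (hnd : E.Nodup) (hmem : ∀ x ∈ E, x ∈ H.edgeSet)
    (hhead : ∃ r, E = e :: r) (hlast : E.getLast? = some g) (hf : f ∈ H.edgeSet) (star B : Prop)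
    (hs : star → g = f) (hns : ¬ star → f ∉ E ∧ RR g f)
    (hB : B → ∃ r, E = e :: d2 :: r ∧ RR e ph ∧ RR ph d2 ∧ ph ∉ E ∧ ph ∈ H.edgeSet)
    (par : Even (E.length + (if B then 1 else 0) + (if star then 0 else 1))) :
    ∃ l, List.IsChain RR (e :: l) ∧ (e :: l).Nodup ∧ (∀ x ∈ e :: l, x ∈ H.edgeSet) ∧
      (e :: l).getLast? = some f ∧ Even (e :: l).length ∧
      (∀ w ∈ e :: l, w ∈ E ∨ w = f ∨ (B ∧ w = ph)) ∧
      ∀ x y, Cons2 (e :: l) x y → Tr E star B e f g ph d2 x y := by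
  have step1 : ∃ l, List.IsChain RR (e :: l) ∧ (e :: l).Nodup ∧ (∀ x ∈ e :: l, x ∈ H.edgeSet) ∧
      (e :: l).getLast? = some g ∧ (e :: l).length = E.length + (if B then 1 else 0) ∧
      (∀ w ∈ e :: l, w ∈ E ∨ (B ∧ w = ph)) ∧
      ∀ x y, Cons2 (e :: l) x y → Tr E star B e f g ph d2 x y := by
    by_cases hb : B
    · obtain ⟨r, rfl, h1, h2, h3, h4⟩ := hB hb
      simp only [List.mem_cons, not_or] at h3
      rw [List.isChain_cons_cons] at hE
      rw [List.getLast?_cons_cons] at hlast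
      rw [List.nodup_cons, List.nodup_cons] at hnd
      simp only [List.mem_cons, not_or] at hnd
      refine ⟨ph :: d2 :: r, ?_, ?_, ?_, ?_, ?_, ?_, ?_⟩
      · rw [List.isChain_cons_cons, List.isChain_cons_cons]
        exact ⟨h1, h2, hE.2⟩
      · simp only [List.nodup_cons, List.mem_cons, not_or]
        exact ⟨⟨fun h => h3.1 h.symm, hnd.1.1, hnd.1.2⟩, ⟨h3.2.1, h3.2.2⟩, hnd.2.1, hnd.2.2⟩
      · intro x hx
        simp only [List.mem_cons] at hx hmem
        rcases hx with h | rfl | h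
        · exact hmem _ (Or.inl h)
        · exact h4
        · exact hmem _ (Or.inr h)
      · rw [List.getLast?_cons_cons, List.getLast?_cons_cons]; exact hlast
      · simp [hb]
      · intro w hw
        simp only [List.mem_cons] at hw ⊢
        tauto
      · intro x y hxy
        rw [Cons2, Cons2] at hxy
        rcases hxy with h | h | h
        · exact Or.inr (Or.inr (Or.inl ⟨hb, h⟩))
        · exact Or.inr (Or.inr (Or.inr ⟨hb, h⟩))
        · have := Cons2_mem _ _ _ h
          exact Or.inl ⟨List.mem_cons_of_mem _ this.1, List.mem_cons_of_mem _ this.2⟩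
    · obtain ⟨r, rfl⟩ := hhead
      refine ⟨r, hE, hnd, hmem, hlast, by simp [hb], fun w hw => Or.inl hw, ?_⟩
      intro x y h
      exact Or.inl (Cons2_mem _ _ _ h)
  obtain ⟨l, h1, h2, h3, h4, h5, h6, h7⟩ := step1
  rw [← h5] at par
  by_cases hst : star
  · refine ⟨l, h1, h2, h3, by rw [h4, hs hst], by simpa [hst] using par, ?_, h7⟩
    intro w hw
    rcases h6 w hw with h | h
    · exact Or.inl h
    · exact Or.inr (Or.inr h)
  obtain ⟨hfE, hgf⟩ := hns hst
  by_cases hfl : f ∈ e :: l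
  · rcases h6 f hfl with h | ⟨hb, h⟩
    · exact absurd h hfE
    obtain ⟨r, hr, k1, k2, k3, k4⟩ := hB hb
    have heE : e ∈ E := by rw [hr]; simp
    have hef : e ≠ f := by rintro rfl; exact hfE heE
    refine ⟨[f], ?_, ?_, ?_, by simp, by simp, ?_, ?_⟩
    · rw [List.isChain_cons_cons]
      exact ⟨h ▸ k1, List.isChain_singleton _⟩
    · simpa using hef
    · intro x hx
      simp only [List.mem_cons, List.not_mem_nil, or_false] at hx
      rcases hx with rfl | rfl
      · exact hmem _ heE
      · exact hf
    · intro w hw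
      simp only [List.mem_cons, List.not_mem_nil, or_false] at hw
      rcases hw with rfl | rfl
      · exact Or.inl heE
      · exact Or.inr (Or.inl rfl)
    · intro x y hxy
      simp only [Cons2, or_false] at hxy
      exact Or.inr (Or.inr (Or.inl ⟨hb, hxy.1, hxy.2.trans h⟩))
  · refine ⟨l ++ [f], ?_, ?_, ?_, ?_, ?_, ?_, ?_⟩
    · rw [← List.cons_append, List.isChain_append]
      refine ⟨h1, List.isChain_singleton _, ?_⟩
      intro x hx y hy
      rw [h4] at hx
      simp at hx hy
      subst hx hy
      exact hgf
    · rw [← List.cons_append, List.nodup_append]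
      refine ⟨h2, by simp, ?_⟩
      intro a ha b hb hab
      simp only [List.mem_cons, List.not_mem_nil, or_false] at hb
      rw [hab, hb] at ha
      exact hfl ha
    · intro x hx
      rw [← List.cons_append, List.mem_append] at hx
      rcases hx with h | h
      · exact h3 x h
      · simp at h; rw [h]; exact hf
    · rw [← List.cons_append, List.getLast?_append]; simp
    · rw [← List.cons_append, List.length_append]
      simpa [hst] using par
    · intro w hw
      rw [← List.cons_append, List.mem_append] at hw
      rcases hw with hw | hw
      · rcases h6 w hw with h | h
        · exact Or.inl h
        · exact Or.inr (Or.inr h)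
      · simp at hw; exact Or.inr (Or.inl hw)
    · intro x y hxy
      rw [← List.cons_append] at hxy
      rcases Cons2_append f _ x y hxy with h | ⟨h, hy⟩
      · exact h7 x y h
      · rw [h4] at h
        simp at h
        exact Or.inr (Or.inl ⟨hst, h.symm, hy⟩)

lemma one_walk (H : SimpleGraph V) (E : List (Sym2 V)) (e f g ph d2 : Sym2 V)
    (hE : E.IsChain RR) (hnd : E.Nodup) (hmem : ∀ x ∈ E, x ∈ H.edgeSet)
    (hhead : ∃ r, E = e :: r) (hlast : E.getLast? = some g) (he : e ∈ H.edgeSet)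
    (hf : f ∈ H.edgeSet) (star B : Prop)
    (hs : star → g = f) (hns : ¬ star → f ∉ E ∧ RR g f)
    (hB : B → ∃ r, E = e :: d2 :: r ∧ RR e ph ∧ RR ph d2 ∧ ph ∉ E ∧ ph ∈ H.edgeSet)
    (par : Even (E.length + (if B then 1 else 0) + (if star then 0 else 1))) :
    ∃ Q : H.lineGraph.Walk ⟨f, hf⟩ ⟨e, he⟩, Q.IsPath ∧ Odd Q.length ∧
      (∀ w ∈ Q.support, w.1 ∈ E ∨ w.1 = f ∨ (B ∧ w.1 = ph)) ∧
      ∀ x y, s(x, y) ∈ Q.edges → Tr E star B e f g ph d2 x.1 y.1 ∨ Tr E star B e f g ph d2 y.1 x.1 := by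
  obtain ⟨l, h1, h2, h3, h4, h5, h6, h7⟩ :=
    one_list H E e f g ph d2 hE hnd hmem hhead hlast hf star B hs hns hB par
  obtain ⟨Q, q1, q2⟩ := lwalk H l e he f hf (fun x hx => h3 x (List.mem_cons_of_mem _ hx)) h1 h4
  refine ⟨Q.reverse, ?_, ?_, ?_, ?_⟩
  · rw [Walk.isPath_reverse_iff, Walk.isPath_def]
    rw [← q1] at h2
    exact List.Nodup.of_map _ h2
  · rw [Walk.length_reverse]
    have := congrArg List.length q1
    rw [List.length_map, Walk.length_support] at this
    rw [← this] at h5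
    obtain ⟨r, hr⟩ := h5
    exact ⟨r - 1, by omega⟩
  · intro w hw
    rw [Walk.support_reverse, List.mem_reverse] at hw
    apply h6
    rw [← q1]
    exact List.mem_map_of_mem hw
  · intro x y hxy
    rw [Walk.edges_reverse, List.mem_reverse] at hxy
    rcases q2 x y hxy with h | h
    · exact Or.inl (h7 _ _ h)
    · exact Or.inr (h7 _ _ h)

lemma assemble (H : SimpleGraph V) (k : ℕ) (v y : V) (E : Fin k → List (Sym2 V))
    (e g ph d2 : Fin k → Sym2 V) (u : Fin k → V) (f : Sym2 V) (i0 : Fin k) (B : Fin k → Prop)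
    (hE : ∀ i, (E i).IsChain RR) (hnd : ∀ i, (E i).Nodup) (hmem : ∀ i, ∀ x ∈ E i, x ∈ H.edgeSet)
    (hhead : ∀ i, ∃ r, E i = e i :: r) (hlast : ∀ i, (E i).getLast? = some (g i))
    (hdis : ∀ i j, i ≠ j → List.Disjoint (E i) (E j))
    (hf : f = g i0) (hfe : f ≠ e i0) (hy : ∀ i, y ∈ g i)
    (he : ∀ i, e i = s(v, u i))
    (hB : ∀ i, B i → ∃ r, E i = e i :: d2 i :: r ∧ u i ∈ d2 i ∧ u i ∈ ph i ∧ ph i ∉ E i ∧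
      ph i ∈ H.edgeSet ∧ v ∉ ph i)
    (par : ∀ i, Even ((E i).length + (if B i then 1 else 0) + (if i = i0 then 0 else 1))) :
    TotallyOddStrongCliqueImmersion H.lineGraph (k + 1) := by
  have heE : ∀ i, e i ∈ E i := by
    intro i; obtain ⟨r, hr⟩ := hhead i; rw [hr]; simp
  have hgE : ∀ i, g i ∈ E i := fun i => List.mem_of_getLast? (hlast i)
  have hee : ∀ i, e i ∈ H.edgeSet := fun i => hmem i _ (heE i)
  have hfE : f ∈ E i0 := hf ▸ hgE i0
  have hfH : f ∈ H.edgeSet := hmem i0 _ hfE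
  have hdj : ∀ i j x, x ∈ E i → x ∈ E j → i = j := by
    intro i j x h1 h2
    by_contra hne
    exact hdis i j hne h1 h2
  have hfi : ∀ i, i ≠ i0 → f ∉ E i := fun i hi h => hi (hdj i i0 f h hfE)
  have hfe' : ∀ i, f ≠ e i := by
    intro i h
    have : i = i0 := hdj i i0 f (h ▸ heE i) hfE
    subst this
    exact hfe h
  have hve : ∀ i, v ∈ e i := by intro i; rw [he]; simp
  have hue : ∀ i, u i ∈ e i := by intro i; rw [he]; simp
  have hphe : ∀ i j, B i → ph i ≠ e j := by
    intro i j hb h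
    obtain ⟨r, _, _, _, _, _, h6⟩ := hB i hb
    exact h6 (h ▸ hve j)
  have hd2 : ∀ i, B i → d2 i ∈ E i := by
    intro i hb
    obtain ⟨r, hr, _⟩ := hB i hb
    rw [hr]; simp
  have hBstar : B i0 → d2 i0 ≠ f := by
    intro hb h
    obtain ⟨r, hr, _⟩ := hB i0 hb
    have hp := par i0
    have hn := hnd i0
    have hl := hlast i0
    rw [if_pos hb, if_pos rfl, hr] at hp
    rw [hr] at hn hl
    cases r with
    | nil => simp at hp; exact absurd hp (by decide)
    | cons a r =>
      rw [List.getLast?_cons_cons, List.getLast?_cons_cons, ← hf, ← h] at hl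
      have := List.mem_of_getLast? hl
      rw [List.nodup_cons, List.nodup_cons] at hn
      exact hn.2.1 this
  have hw := fun i => one_walk H (E i) (e i) f (g i) (ph i) (d2 i) (hE i) (hnd i) (hmem i) (hhead i)
    (hlast i) (hee i) hfH (i = i0) (B i) (fun h => by rw [h, hf])
    (fun h => ⟨hfi i h, fun h' => hfi i h (h' ▸ hgE i), y, hy i, hf ▸ hy i0⟩)
    (fun hb => by
      obtain ⟨r, k1, k2, k3, k4, k5, k6⟩ := hB i hb
      exact ⟨r, k1, ⟨(hphe i i hb).symm, u i, hue i, k3⟩,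
        ⟨fun h => k4 (h ▸ hd2 i hb), u i, k3, k2⟩, k4, k5⟩) (by convert par i)
  choose Q q1 q2 q3 q4 using hw
  have hemem : ∀ i j, e i ∈ E j → i = j := fun i j h => hdj i j _ (heE i) h
  have heinj : ∀ i j, e i = e j → i = j := fun i j h => hemem i j (h ▸ heE j)
  refine build H.lineGraph k ⟨f, hfH⟩ (fun i => ⟨e i, hee i⟩) ?_ ?_ ?_ Q q1 q2 ?_ ?_
  · intro i j h
    exact heinj i j (Subtype.ext_iff.1 h)
  · intro i h
    exact hfe' i (Subtype.ext_iff.1 h).symm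
  · intro i j hij
    rw [lineGraph_adj_iff_exists]
    exact ⟨fun h => hij (heinj i j (Subtype.ext_iff.1 h)), v, hve i, hve j⟩
  · intro i j h
    rcases q3 i _ h with h | h | ⟨hb, h⟩
    · exact hemem j i h
    · exact absurd h.symm (hfe' j)
    · exact absurd h.symm (hphe i j hb)
  · have main : ∀ i j, i ≠ j → ∀ x y, Tr (E i) (i = i0) (B i) (e i) f (g i) (ph i) (d2 i) x y →
        (Tr (E j) (j = i0) (B j) (e j) f (g j) (ph j) (d2 j) x y ∨
        Tr (E j) (j = i0) (B j) (e j) f (g j) (ph j) (d2 j) y x) → False := by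
      intro i j hij x y h1 h2
      have hdu : B i → B j → d2 i = ph j → d2 j = ph i → False := by
        intro hbi hbj e1 e2
        obtain ⟨_, _, k2, k3, _, _, _⟩ := hB i hbi
        obtain ⟨_, _, l2, l3, _, _, _⟩ := hB j hbj
        rw [← e2] at k3
        rw [← e1] at l3
        have hu : u i ≠ u j := fun h => hij (heinj i j (by rw [he, he, h]))
        have r1 := (Sym2.mem_and_mem_iff hu).1 ⟨k2, l3⟩
        have r2 := (Sym2.mem_and_mem_iff hu).1 ⟨k3, l2⟩
        exact hij (hdj i j (d2 i) (hd2 i hbi) (by rw [r1, ← r2]; exact hd2 j hbj))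
      have a1 := hdj i j
      have a2 := heE i
      have a3 := heE j
      have a4 := hgE i
      have a5 := hgE j
      have a6 := hd2 i
      have a7 := hd2 j
      have a8 := hfi i
      have a9 := hfi j
      have b1 := hfe' i
      have b2 := hfe' j
      have b3 := hphe i j
      have b4 := hphe j i
      have b5 : B i → i = i0 → d2 i ≠ f := by
        intro hb h; subst h; exact hBstar hb
      have b6 : B j → j = i0 → d2 j ≠ f := by
        intro hb h; subst h; exact hBstar hb
      clear hBstar hE hnd hmem hhead hlast par hB q1 q2 q3 q4 hdj hdis
      unfold Tr at h1 h2
      grind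
    intro i j hij w hw1 hw2
    induction w using Sym2.ind with
    | _ x y =>
      rcases q4 i x y hw1 with h | h <;> rcases q4 j x y hw2 with h' | h'
      · exact main i j hij _ _ h (Or.inl h')
      · exact main i j hij _ _ h (Or.inr h')
      · exact main i j hij _ _ h (Or.inr h')
      · exact main i j hij _ _ h (Or.inl h')

end TOI
end Lists

open SimpleGraph

section Final
open Classical
set_option linter.unusedSectionVars false
set_option linter.unusedVariables false

namespace TOI

variable {V : Type*}

lemma path_chain {G : SimpleGraph V} {a b : V} (p : G.Walk a b) (hp : p.IsPath) :
    p.edges.IsChain RR := by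
  induction p with
  | nil => simp
  | @cons a c b h q ih =>
    have hq := hp.of_cons
    have hn := hp.isTrail.edges_nodup
    have hi := ih hq
    cases q with
    | nil => simp
    | @cons _ d _ h' q' =>
      rw [Walk.edges_cons, Walk.edges_cons] at hn ⊢
      rw [Walk.edges_cons] at hi
      rw [List.isChain_cons_cons]
      refine ⟨⟨?_, c, by simp, by simp⟩, hi⟩
      intro hh
      rw [List.nodup_cons] at hn
      apply hn.1
      rw [hh]; simp

lemma path_last {G : SimpleGraph V} {a b : V} (p : G.Walk a b) (hab : a ≠ b) :
    ∃ g, p.edges.getLast? = some g ∧ b ∈ g := by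
  induction p with
  | nil => exact absurd rfl hab
  | @cons a c b h q ih =>
    by_cases hcb : c = b
    · subst hcb
      cases q with
      | nil => exact ⟨s(a, c), by simp, by simp⟩
      | @cons _ d _ h' q' =>
        by_cases hdc : d = c
        · exact absurd hdc h'.ne'
        · clear ih
          have : ∀ {x y : V} (w : G.Walk x y), w.edges ≠ [] → ∃ g, w.edges.getLast? = some g ∧ y ∈ g := by
            intro x y w
            induction w with
            | nil => simp
            | @cons x m y hx w ihw =>
              intro _
              cases w with
              | nil => exact ⟨s(x, m), by simp, by simp⟩
              | @cons _ n _ hm w' =>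
                obtain ⟨g, h1, h2⟩ := ihw (by simp)
                refine ⟨g, ?_, h2⟩
                rw [Walk.edges_cons, Walk.edges_cons, List.getLast?_cons_cons]
                rw [Walk.edges_cons] at h1
                exact h1
          exact this _ (by simp)
    · obtain ⟨g, h1, h2⟩ := ih hcb
      refine ⟨g, ?_, h2⟩
      cases q with
      | nil => exact absurd rfl hcb
      | @cons _ d _ h' q' =>
        rw [Walk.edges_cons, Walk.edges_cons, List.getLast?_cons_cons]
        rw [Walk.edges_cons] at h1
        exact h1

variable [Fintype V]

lemma path_data {G : SimpleGraph V} {v y : V} (p : G.Walk v y) (hp : p.IsPath) (hvy : v ≠ y) :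
    ∃ u, (∃ r, p.edges = s(v, u) :: r) ∧ G.Adj v u ∧
      (2 ≤ p.length → 3 ≤ dg G u → ∃ d2 ph r, p.edges = s(v, u) :: d2 :: r ∧ u ∈ d2 ∧ u ∈ ph ∧
        ph ∉ p.edges ∧ ph ∈ G.edgeSet ∧ v ∉ ph) := by
  cases p with
  | nil => exact absurd rfl hvy
  | @cons _ u _ h q =>
    refine ⟨u, ⟨q.edges, by simp⟩, h, ?_⟩
    intro hl hd
    cases q with
    | nil => simp at hl
    | @cons _ w _ h' q' =>
      have hz : ∃ z, G.Adj u z ∧ z ≠ v ∧ z ≠ w := by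
        by_contra hcon
        push Not at hcon
        have : (Finset.univ.filter (G.Adj u)) ⊆ {v, w} := by
          intro z hz
          simp only [Finset.mem_filter, Finset.mem_univ, true_and] at hz
          simp only [Finset.mem_insert, Finset.mem_singleton]
          by_cases hzv : z = v
          · exact Or.inl hzv
          · exact Or.inr (hcon z hz hzv)
        have h1 := Finset.card_le_card this
        have h2 : ({v, w} : Finset V).card ≤ 2 := Finset.card_le_two
        unfold dg at hd
        omega
      obtain ⟨z, hz1, hz2, hz3⟩ := hz
      refine ⟨s(u, w), s(u, z), q'.edges, by simp, by simp, by simp, ?_, hz1, ?_⟩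
      · intro hm
        rw [Walk.edges_cons, Walk.edges_cons, List.mem_cons, List.mem_cons] at hm
        rcases hm with hm | hm | hm
        · rw [Sym2.eq_iff] at hm
          rcases hm with ⟨a, b⟩ | ⟨a, b⟩
          · exact h.ne' a
          · exact hz2 b
        · rw [Sym2.eq_iff] at hm
          rcases hm with ⟨a, b⟩ | ⟨a, b⟩
          · exact hz3 b
          · exact h'.ne a
        · have := Walk.fst_mem_support_of_mem_edges _ hm
          have h3 := hp.of_cons
          rw [Walk.cons_isPath_iff] at h3
          exact h3.2 this
      · intro hm
        rw [Sym2.mem_iff] at hm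
        rcases hm with hm | hm
        · exact h.ne hm
        · exact hz2 hm.symm

lemma two_le_dg {G : SimpleGraph V} {v x y : V} (hxy : x ≠ y) (hx : G.Adj v x) (hy : G.Adj v y) :
    2 ≤ dg G v := by
  unfold dg
  rw [← Finset.card_pair hxy]
  apply Finset.card_le_card
  intro z hz
  simp only [Finset.mem_insert, Finset.mem_singleton] at hz
  simp only [Finset.mem_filter, Finset.mem_univ, true_and]
  rcases hz with rfl | rfl <;> assumption

lemma crit_case (H G : SimpleGraph V) (hGH : G ≤ H) (k : ℕ) (hk : 3 ≤ k) (hG : Crit G k)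
    (hd : ∀ u, dg G u ≤ k) : TotallyOddStrongCliqueImmersion H.lineGraph (k + 1) := by
  obtain ⟨v, y, hvy, hv, hcut⟩ := hG.cut hd
  obtain ⟨P, hP, hdis⟩ := menger hvy k hcut
  have hdata := fun i => path_data (P i) (hP i) hvy
  choose u hr hadj hdet using hdata
  choose g hg1 hg2 using fun i => path_last (P i) hvy
  have hme : ∀ i, s(v, u i) ∈ (P i).edges := by
    intro i; obtain ⟨r, hr⟩ := hr i; rw [hr]; simp
  have hinj : ∀ i j, u i = u j → i = j := by
    intro i j h
    by_contra hne
    exact hdis i j hne (hme i) (h ▸ hme j)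
  have hdg2 : ∀ i, 2 ≤ dg G (u i) := by
    intro i
    obtain ⟨a, b, h1, h2, h3, _⟩ := hG.nbrs hd (hadj i).symm
    exact two_le_dg h1 h2 h3
  have hsm : ∀ i j, dg G (u i) < 3 → dg G (u j) < 3 → i = j := by
    intro i j h1 h2
    by_contra hne
    have := hdg2 i
    have := hdg2 j
    exact hG.lemmaA hk hd (fun h => hne (hinj i j h)) (hadj i) (hadj j) (by omega) (by omega)
  have hpos : ∀ i, 1 ≤ (P i).length := by
    intro i
    by_contra h
    exact hvy (Walk.eq_of_length_eq_zero (p := P i) (by omega))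
  have hone : ∀ i j, (P i).length = 1 → (P j).length = 1 → i = j := by
    intro i j h1 h2
    apply hinj
    have key : ∀ i, (P i).length = 1 → u i = y := by
      intro i h
      obtain ⟨r, hr⟩ := hr i
      have hl := hg1 i
      have hle : (P i).edges.length = 1 := by rw [Walk.length_edges, h]
      rw [hr] at hl hle
      have : r = [] := by simpa using hle
      subst this
      simp only [List.getLast?_singleton, Option.some.injEq] at hl
      have h2 := hg2 i
      rw [← hl, Sym2.mem_iff] at h2
      rcases h2 with h2 | h2
      · exact absurd h2.symm hvy
      · exact h2.symm
    rw [key i h1, key j h2]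
  have hchoice : ∃ (i0 : Fin k) (B : Fin k → Prop), 2 ≤ (P i0).length ∧
      (∀ i, B i → 2 ≤ (P i).length ∧ 3 ≤ dg G (u i)) ∧
      (∀ i, Even ((P i).length + (if B i then 1 else 0) + (if i = i0 then 0 else 1))) := by
    by_cases hev : ∃ i, Even (P i).length
    · have : ∃ i0, Even (P i0).length ∧
          ∀ i, Even (P i).length → i ≠ i0 → 3 ≤ dg G (u i) := by
        by_cases hsp : ∃ i, Even (P i).length ∧ dg G (u i) < 3
        · obtain ⟨i0, h1, h2⟩ := hsp
          refine ⟨i0, h1, fun i _ hi => ?_⟩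
          by_contra h
          exact hi (hsm i i0 (by omega) h2)
        · obtain ⟨i0, h1⟩ := hev
          refine ⟨i0, h1, fun i hi _ => ?_⟩
          by_contra h
          exact hsp ⟨i, hi, by omega⟩
      obtain ⟨i0, h1, h2⟩ := this
      have hev2 : ∀ i, Even (P i).length → 2 ≤ (P i).length := by
        intro i h
        have := hpos i
        obtain ⟨r, hr⟩ := h
        omega
      refine ⟨i0, fun i => Even (P i).length ∧ i ≠ i0, hev2 i0 h1, ?_, ?_⟩
      · rintro i ⟨a, b⟩
        exact ⟨hev2 i a, h2 i a b⟩
      · intro i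
        by_cases hi : i = i0
        · subst hi; simpa using h1
        · by_cases he : Even (P i).length
          · simp only [he, hi, ne_eq, not_false_eq_true, and_self, if_true, if_false]
            obtain ⟨r, hr⟩ := he
            exact ⟨r + 1, by omega⟩
          · simp only [he, hi, false_and, if_false]
            rw [Nat.not_even_iff_odd] at he
            obtain ⟨r, hr⟩ := he
            exact ⟨r + 1, by omega⟩
    · have : ∃ i0, 2 ≤ (P i0).length ∧ 3 ≤ dg G (u i0) := by
        by_contra hcon
        push Not at hcon
        have hc : ∀ i : Fin k, (P i).length = 1 ∨ dg G (u i) < 3 := by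
          intro i
          have := hpos i
          by_cases h : 2 ≤ (P i).length
          · exact Or.inr (hcon i h)
          · left; omega
        have n01 : (⟨0, by omega⟩ : Fin k) ≠ ⟨1, by omega⟩ := by simp
        have n02 : (⟨0, by omega⟩ : Fin k) ≠ ⟨2, by omega⟩ := by simp
        have n12 : (⟨1, by omega⟩ : Fin k) ≠ ⟨2, by omega⟩ := by simp
        rcases hc ⟨0, by omega⟩ with h0 | h0 <;> rcases hc ⟨1, by omega⟩ with h1 | h1 <;>
          rcases hc ⟨2, by omega⟩ with h2 | h2 <;>
          first
          | exact n01 (hone _ _ h0 h1)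
          | exact n01 (hsm _ _ h0 h1)
          | exact n02 (hone _ _ h0 h2)
          | exact n02 (hsm _ _ h0 h2)
          | exact n12 (hone _ _ h1 h2)
          | exact n12 (hsm _ _ h1 h2)
      obtain ⟨i0, h1, h2⟩ := this
      refine ⟨i0, fun i => i = i0, h1, ?_, ?_⟩
      · rintro i rfl
        exact ⟨h1, h2⟩
      · intro i
        have he : ¬ Even (P i).length := fun h => hev ⟨i, h⟩
        rw [Nat.not_even_iff_odd] at he
        obtain ⟨r, hr⟩ := he
        by_cases hi : i = i0
        · simp only [hi, if_true]
          subst hi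
          exact ⟨r + 1, by omega⟩
        · simp only [hi, if_false]
          exact ⟨r + 1, by omega⟩
  obtain ⟨i0, B, hi0, hB, hpar⟩ := hchoice
  have hdet' : ∀ i, ∃ d2 ph, B i → ∃ r, (P i).edges = s(v, u i) :: d2 :: r ∧ u i ∈ d2 ∧ u i ∈ ph ∧
        ph ∉ (P i).edges ∧ ph ∈ G.edgeSet ∧ v ∉ ph := by
    intro i
    by_cases hb : B i
    · obtain ⟨d2, ph, r, h⟩ := hdet i (hB i hb).1 (hB i hb).2
      exact ⟨d2, ph, fun _ => ⟨r, h⟩⟩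
    · exact ⟨g i, g i, fun h => absurd h hb⟩
  choose d2 ph hdp using hdet'
  refine assemble H k v y (fun i => (P i).edges) (fun i => s(v, u i)) g ph d2 u (g i0) i0 B
    (fun i => path_chain _ (hP i)) (fun i => (hP i).isTrail.edges_nodup)
    (fun i x hx => SimpleGraph.edgeSet_mono hGH ((P i).edges_subset_edgeSet hx)) hr hg1 hdis rfl ?_ hg2
    (fun i => rfl) ?_ ?_
  · intro h
    obtain ⟨r, hr⟩ := hr i0
    have hl := hg1 i0
    have hn := (hP i0).isTrail.edges_nodup
    have hle : 2 ≤ (P i0).edges.length := by rw [Walk.length_edges]; exact hi0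
    rw [hr] at hl hn hle
    cases r with
    | nil => simp at hle
    | cons a r =>
      rw [List.getLast?_cons_cons, h] at hl
      rw [List.nodup_cons] at hn
      exact hn.1 (List.mem_of_getLast? hl)
  · intro i hb
    obtain ⟨r, h1, h2, h3, h4, h5, h6⟩ := hdp i hb
    exact ⟨r, h1, h2, h3, h4, SimpleGraph.edgeSet_mono hGH h5, h6⟩
  · intro i
    rw [Walk.length_edges]
    convert hpar i

lemma zero_case {W : Type*} (L : SimpleGraph W) : TotallyOddStrongCliqueImmersion L 0 :=
  ⟨⟨fun i => i.elim0, fun i => i.elim0⟩, fun i => i.elim0, fun i => i.elim0, fun i => i.elim0,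
    fun i => i.elim0, fun i => i.elim0⟩

lemma final (H : SimpleGraph V) (t : ℕ)
    (ht : (H.lineGraph).chromaticNumber = (t : ℕ∞)) :
    TotallyOddStrongCliqueImmersion H.lineGraph t := by
  cases t with
  | zero => exact zero_case _
  | succ k =>
    by_cases hbig : ∃ v, k + 1 ≤ dg H v
    · obtain ⟨v, hv⟩ := hbig
      obtain ⟨S, hS, hc⟩ := Finset.exists_subset_card_eq hv
      refine star_case H v (k + 1) (fun i => ((S.equivFinOfCardEq hc).symm i : V)) ?_ ?_
      · intro i j h
        exact (S.equivFinOfCardEq hc).symm.injective (Subtype.ext h)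
      · intro i
        have := hS ((S.equivFinOfCardEq hc).symm i).2
        simpa using this
    · push Not at hbig
      have hnc : ¬ H.lineGraph.Colorable k := by
        intro h
        have := h.chromaticNumber_le
        rw [ht] at this
        have : k + 1 ≤ k := by exact_mod_cast this
        omega
      obtain ⟨G, hGH, hG⟩ := exists_crit H k (fun h => hnc h.colorable)
      have hd : ∀ u, dg G u ≤ k := by
        intro u
        have h1 := dg_mono (G := H) (G' := G) u (fun b hb => hGH hb)
        have := hbig u
        omega
      obtain ⟨a, b, hab⟩ := hG.edge
      obtain ⟨x, y, h1, h2, h3, _⟩ := hG.nbrs hd hab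
      have h4 := two_le_dg h1 h2 h3
      have h5 := hd a
      by_cases hk : k = 2
      · subst hk
        exact three_case _ hnc
      · exact crit_case H G hGH k (by omega) hG hd

end TOI
end Final



/-- The line graph of a simple graph contains a totally odd strong immersion
of the complete graph on `χ(G)` vertices. -/
theorem statement2 {V : Type*} [Fintype V] (H : SimpleGraph V) (t : ℕ)
    (ht : (H.lineGraph).chromaticNumber = (t : ℕ∞)) :
    TotallyOddStrongCliqueImmersion H.lineGraph t := 
  TOI.final H t ht
end
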